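/- arXiv:2112.07058 — 7 statements merged into one kernel-verified Lean document; each statement's English description precedes it below -/
import Mathlib

section
/- Let a, α ∈ (0, π) be real numbers satisfying the equilateral spherical law-of-cosines relation cos a = (cos a)² + (sin a)²·cos α (so that a is the common side length and α the common angle of an equilateral spherical triangle). If cos a, sin a, cos α and sin α are all rational numbers, then a = π/2 and α = π/2. In other words, the unique rational equilateral spherical Heron triangle has all sides and all angles equal to π/2. -/
open Real

lemma exists_smaller_sq_add_sq_and_four_sq_add_sq {x y m n : ℤ}
    (hxy : IsCoprime x y) (hmn : IsCoprime (2 * m) n)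
    (hx : x ≠ 0) (hy : y ≠ 0) (hprod : m * n = x * y)
    (hdiff : x ^ 2 - y ^ 2 = 4 * m ^ 2 - n ^ 2) :
    ∃ a d b c : ℤ, a ≠ 0 ∧ d ≠ 0 ∧ a * d ∣ x * y ∧
      a ^ 2 + d ^ 2 = b ^ 2 ∧ 4 * a ^ 2 + d ^ 2 = c ^ 2 := by
  obtain ⟨α, β, ⟨γ, rfl⟩, ⟨δ, rfl⟩, rfl⟩ :=
    exists_dvd_and_dvd_of_dvd_mul (Dvd.intro y hprod.symm)
  have hα : α ≠ 0 := left_ne_zero_of_mul hx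
  obtain rfl : y = γ * δ := mul_left_cancel₀ hx (by linear_combination -hprod)
  have hδ : δ ≠ 0 := right_ne_zero_of_mul hy
  have hγ : γ ≠ 0 := left_ne_zero_of_mul hy
  have hβγ : IsCoprime β γ := hxy.of_mul_left_right.of_mul_right_left
  have hαδ : IsCoprime α δ :=
    hmn.of_mul_left_right.of_mul_left_left.of_mul_right_right
  have key : β ^ 2 * (α ^ 2 + δ ^ 2) = γ ^ 2 * (4 * α ^ 2 + δ ^ 2) := by
    linear_combination hdiff
  obtain ⟨k, hk⟩ : γ ^ 2 ∣ α ^ 2 + δ ^ 2 :=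
    (hβγ.pow (m := 2) (n := 2)).symm.dvd_of_dvd_mul_left (Dvd.intro _ key.symm)
  have hk' : 4 * α ^ 2 + δ ^ 2 = β ^ 2 * k := by
    refine mul_left_cancel₀ (pow_ne_zero 2 hγ) ?_
    rw [← key, hk]; ring
  have hk0 : 0 < k := by
    have h1 : 0 < γ ^ 2 * k := by rw [← hk]; positivity
    exact pos_of_mul_pos_right h1 (sq_nonneg γ)
  have hk3 : k ∣ 3 := by
    obtain ⟨u, v, huv⟩ := hαδ.pow (m := 2) (n := 2)
    refine ⟨u * (β ^ 2 - γ ^ 2) + v * (4 * γ ^ 2 - β ^ 2), ?_⟩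
    linear_combination (-3) * huv + (u - v) * hk' + (4 * v - u) * hk
  have hkle : k ≤ 3 := Int.le_of_dvd (by norm_num) hk3
  have hk1 : k = 1 := by
    interval_cases k
    · rfl
    · norm_num at hk3
    · exfalso
      have h3 : (3 : ℤ) ∣ α ^ 2 + δ ^ 2 := ⟨γ ^ 2, by linarith⟩
      have h3' : (3 : ℤ) ∣ α ∧ (3 : ℤ) ∣ δ := by
        have hs : ∀ t : ℤ, t % 3 = 0 ∨ t ^ 2 % 3 = 1 := by
          intro t
          have : t % 3 = 0 ∨ t % 3 = 1 ∨ t % 3 = 2 := by omega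
          rcases this with h | h | h <;> simp [pow_two, Int.mul_emod, h]
        rcases hs α with h | h <;> rcases hs δ with h' | h'
        · omega
        · have : α ^ 2 % 3 = 0 := by simp [pow_two, Int.mul_emod, h]
          omega
        · have : δ ^ 2 % 3 = 0 := by simp [pow_two, Int.mul_emod, h']
          omega
        · omega
      have := hαδ.isUnit_of_dvd' h3'.1 h3'.2
      norm_num [Int.isUnit_iff] at this
  subst hk1
  exact ⟨α, δ, γ, β, hα, hδ, ⟨β * γ, by ring⟩, by linarith, by linarith⟩

/-- There are no nonzero integers `a`, `d` such that `a ^ 2 + d ^ 2` and `4 * a ^ 2 + d ^ 2`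
are both squares. -/
theorem no_sq_add_sq_and_four_sq_add_sq {a d b c : ℤ} (ha : a ≠ 0) (hd : d ≠ 0)
    (hb : a ^ 2 + d ^ 2 = b ^ 2) (hc : 4 * a ^ 2 + d ^ 2 = c ^ 2) : False := by
  induction hN : (a * d).natAbs using Nat.strong_induction_on generalizing a d b c with
  | _ N ih =>
  have descend : ∀ {a' d' b' c' : ℤ}, a' ≠ 0 → d' ≠ 0 → a' ^ 2 + d' ^ 2 = b' ^ 2 →
      4 * a' ^ 2 + d' ^ 2 = c' ^ 2 → ∀ k : ℤ, a * d = a' * d' * k → k.natAbs ≠ 1 → False := by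
    intro a' d' b' c' ha' hd' hb' hc' k hk hk1
    refine ih _ ?_ ha' hd' hb' hc' rfl
    have h1 : 0 < (a' * d').natAbs := Int.natAbs_pos.2 (mul_ne_zero ha' hd')
    have h0 : 0 < (a * d).natAbs := Int.natAbs_pos.2 (mul_ne_zero ha hd)
    rw [← hN]
    rw [hk, Int.natAbs_mul (a' * d') k] at h0 ⊢
    have : 0 < k.natAbs := Nat.pos_of_mul_pos_left h0
    have : 1 < k.natAbs := by omega
    exact lt_mul_of_one_lt_right h1 this
  have hcop : IsCoprime a d := by
    rw [Int.isCoprime_iff_gcd_eq_one]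
    by_contra hg
    obtain ⟨a', ha'⟩ := Int.gcd_dvd_left a d
    obtain ⟨d', hd'⟩ := Int.gcd_dvd_right a d
    have hg0 : (Int.gcd a d : ℤ) ≠ 0 := by
      exact_mod_cast fun h => ha (Int.gcd_eq_zero_iff.1 h).1
    have hg1 : (Int.gcd a d : ℤ).natAbs ≠ 1 := by simpa using hg
    generalize (Int.gcd a d : ℤ) = g at *
    subst ha' hd'
    obtain ⟨b', rfl⟩ : g ∣ b :=
      (Int.pow_dvd_pow_iff two_ne_zero).1 ⟨a' ^ 2 + d' ^ 2, by rw [← hb]; ring⟩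
    obtain ⟨c', rfl⟩ : g ∣ c :=
      (Int.pow_dvd_pow_iff two_ne_zero).1 ⟨4 * a' ^ 2 + d' ^ 2, by rw [← hc]; ring⟩
    have hg2 : g ^ 2 ≠ 0 := pow_ne_zero 2 hg0
    refine descend (right_ne_zero_of_mul ha) (right_ne_zero_of_mul hd)
      (b' := b') (c' := c') (mul_left_cancel₀ hg2 (by linear_combination hb))
      (mul_left_cancel₀ hg2 (by linear_combination hc)) (g * g) (by ring) ?_
    rw [Int.natAbs_mul]
    exact fun h => hg1 (Nat.eq_one_of_mul_eq_one_left h)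
  have hdodd : d % 2 = 1 := by
    by_contra hd2
    obtain ⟨e, rfl⟩ : (2 : ℤ) ∣ d := by omega
    obtain ⟨f, rfl⟩ : (2 : ℤ) ∣ c :=
      (Int.pow_dvd_pow_iff two_ne_zero).1 ⟨a ^ 2 + e ^ 2, by rw [← hc]; ring⟩
    exact descend (right_ne_zero_of_mul hd) ha (b' := f) (c' := b) (by linarith)
      (by linarith) 2 (by ring) (by norm_num)
  have hb0 : b ≠ 0 := by
    rintro rfl
    have : 0 < a ^ 2 := by positivity
    nlinarith
  have hc0 : c ≠ 0 := by
    rintro rfl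
    have : 0 < a ^ 2 := by positivity
    nlinarith
  have p1 : PythagoreanTriple d a |b| := by
    unfold PythagoreanTriple; rw [abs_mul_abs_self]; linarith
  have p2 : PythagoreanTriple d (2 * a) |c| := by
    unfold PythagoreanTriple; rw [abs_mul_abs_self]; linarith
  have hcop2 : IsCoprime d (2 * a) := by
    refine IsCoprime.mul_right ?_ hcop.symm
    exact ⟨1, -(d / 2), by omega⟩
  obtain ⟨x, y, hxd, hxa, -, hxy, -, -⟩ := p1.coprime_classification'
    (Int.isCoprime_iff_gcd_eq_one.1 hcop.symm) hdodd (abs_pos.2 hb0)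
  obtain ⟨m, n, hmd, hma, -, hmn, hpar, -⟩ := p2.coprime_classification'
    (Int.isCoprime_iff_gcd_eq_one.1 hcop2) hdodd (abs_pos.2 hc0)
  rw [← Int.isCoprime_iff_gcd_eq_one] at hxy hmn
  have hprod : m * n = 2 * (x * y) := by linarith
  have hxy0 : x * y ≠ 0 := fun h => ha (by rw [hxa, mul_assoc, h, mul_zero])
  have finish : ∀ a' d' b' c' : ℤ, a' ≠ 0 → d' ≠ 0 → a' * d' ∣ x * y →
      a' ^ 2 + d' ^ 2 = b' ^ 2 → 4 * a' ^ 2 + d' ^ 2 = c' ^ 2 → False := by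
    rintro a' d' b' c' ha' hd' ⟨k, hk⟩ hb' hc'
    refine descend ha' hd' hb' hc' (2 * k * d) ?_ ?_
    · rw [hxa, mul_assoc 2, hk]; ring
    · rw [mul_assoc]
      omega
  rcases hpar with ⟨h, -⟩ | ⟨-, h⟩
  · obtain ⟨l, rfl⟩ : (2 : ℤ) ∣ m := by omega
    obtain ⟨a', d', b', c', h1, h2, h3, h4, h5⟩ :=
      exists_smaller_sq_add_sq_and_four_sq_add_sq hxy hmn
      (left_ne_zero_of_mul hxy0) (right_ne_zero_of_mul hxy0) (by linarith) (by linarith)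
    exact finish a' d' b' c' h1 h2 h3 h4 h5
  · obtain ⟨l, rfl⟩ : (2 : ℤ) ∣ n := by omega
    obtain ⟨a', d', b', c', h1, h2, h3, h4, h5⟩ :=
      exists_smaller_sq_add_sq_and_four_sq_add_sq hxy.symm hmn.symm
      (right_ne_zero_of_mul hxy0) (left_ne_zero_of_mul hxy0) (by linarith) (by linarith)
    exact finish a' d' b' c' h1 h2 (by rwa [mul_comm x]) h4 h5

theorem no_rat_sq_add_sq_and_four_sq_add_sq {a d b c : ℚ} (ha : a ≠ 0) (hd : d ≠ 0)
    (hb : a ^ 2 + d ^ 2 = b ^ 2) (hc : 4 * a ^ 2 + d ^ 2 = c ^ 2) : False := by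
  obtain ⟨⟨N, hN⟩, hint⟩ := IsLocalization.exist_integer_multiples_of_finset
    (nonZeroDivisors ℤ) ({a, d, b, c} : Finset ℚ)
  have hN0 : (N : ℚ) ≠ 0 := by exact_mod_cast nonZeroDivisors.ne_zero hN
  simp only [Finset.mem_insert, Finset.mem_singleton, forall_eq_or_imp, forall_eq,
    IsLocalization.IsInteger, RingHom.mem_rangeS, zsmul_eq_mul, eq_intCast] at hint
  obtain ⟨⟨a', ha'⟩, ⟨d', hd'⟩, ⟨b', hb'⟩, ⟨c', hc'⟩⟩ := hint
  refine no_sq_add_sq_and_four_sq_add_sq (a := a') (d := d') (b := b') (c := c') ?_ ?_ ?_ ?_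
  · rintro rfl
    exact mul_ne_zero hN0 ha (by simpa using ha'.symm)
  · rintro rfl
    exact mul_ne_zero hN0 hd (by simpa using hd'.symm)
  · have : (a' : ℚ) ^ 2 + d' ^ 2 = b' ^ 2 := by
      rw [ha', hd', hb']; linear_combination (N : ℚ) ^ 2 * hb
    exact_mod_cast this
  · have : 4 * (a' : ℚ) ^ 2 + d' ^ 2 = c' ^ 2 := by
      rw [ha', hd', hc']; linear_combination (N : ℚ) ^ 2 * hc
    exact_mod_cast this

lemma rat_eq_zero_of_sq_eq {c s y : ℚ} (hs : s ≠ 0) (hcs : s ^ 2 = 1 - c ^ 2)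
    (hy : y ^ 2 = 1 + 2 * c) : c = 0 := by
  have hy0 : y ≠ 0 := by
    rintro rfl
    obtain rfl : c = -1 / 2 := by linarith
    have h3 : IsSquare (3 : ℚ) := ⟨2 * s, by linarith⟩
    rw [show (3 : ℚ) = ((3 : ℕ) : ℚ) by norm_num, Rat.isSquare_natCast_iff] at h3
    exact Nat.prime_three.prime.not_isSquare h3
  by_contra hc
  have hd : c * (c + 2) ≠ 0 := by
    refine mul_ne_zero hc fun h => ?_
    obtain rfl : c = -2 := by linarith
    nlinarith [sq_nonneg y]
  -- The doubling formula on `Y ^ 2 = X * (X + 1) * (X + 4)` at `X = -2 * (1 + c)`.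
  refine no_rat_sq_add_sq_and_four_sq_add_sq (mul_ne_zero hy0 hs) hd
    (b := c ^ 2 + c + 1) (c := c ^ 2 - 2 * c - 2) ?_ ?_
  · rw [mul_pow, hcs, hy]; ring
  · rw [mul_pow, hcs, hy]; ring

/-- the unique rational equilateral spherical Heron triangle has
all sides and all angles equal to `π/2`. -/
theorem equilateral_spherical_heron_unique
    (a α : ℝ) (ha0 : 0 < a) (haπ : a < π) (hα0 : 0 < α) (hαπ : α < π)
    (hlaw : Real.cos a = (Real.cos a) ^ 2 + (Real.sin a) ^ 2 * Real.cos α)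
    (hca : ∃ q : ℚ, (q : ℝ) = Real.cos a)
    (hsa : ∃ q : ℚ, (q : ℝ) = Real.sin a)
    (hcα : ∃ q : ℚ, (q : ℝ) = Real.cos α)
    (hsα : ∃ q : ℚ, (q : ℝ) = Real.sin α) :
    a = π / 2 ∧ α = π / 2 := by
  obtain ⟨c, hc⟩ := hca
  obtain ⟨s, hs⟩ := hsa
  obtain ⟨t, ht⟩ := hsα
  have hsin : 0 < Real.sin a := Real.sin_pos_of_pos_of_lt_pi ha0 haπ
  have hsq := Real.sin_sq_add_cos_sq a
  have hsqα := Real.sin_sq_add_cos_sq α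
  have hcos : Real.cos a = (1 + Real.cos a) * Real.cos α := by
    have h1 : 1 - Real.cos a ≠ 0 := fun h => by nlinarith
    refine mul_left_cancel₀ h1 ?_
    linear_combination hlaw + Real.cos α * hsq
  have hs0 : s ≠ 0 := by
    rintro rfl
    simp at hs
    exact hsin.ne hs
  have hc0 : c = 0 := by
    refine rat_eq_zero_of_sq_eq (y := (1 + c) * t) hs0 ?_ ?_
    · have : (s : ℝ) ^ 2 = 1 - (c : ℝ) ^ 2 := by rw [hs, hc]; linarith
      exact_mod_cast this
    · have : ((1 + (c : ℝ)) * t) ^ 2 = 1 + 2 * c := by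
        rw [hc, ht]
        linear_combination (1 + Real.cos a) ^ 2 * hsqα
          + (Real.cos a + (1 + Real.cos a) * Real.cos α) * hcos
      exact_mod_cast this
  have hcosa : Real.cos a = 0 := by rw [← hc, hc0, Rat.cast_zero]
  have hcosα : Real.cos α = 0 := by simpa [hcosa] using hcos.symm
  have eq_half : ∀ x : ℝ, 0 < x → x < π → Real.cos x = 0 → x = π / 2 := fun x h0 h1 h =>
    Real.injOn_cos ⟨h0.le, h1.le⟩ ⟨by positivity, by linarith [Real.pi_pos]⟩
      (by rw [h, Real.cos_pi_div_two])
  exact ⟨eq_half a ha0 haπ hcosa, eq_half α hα0 hαπ hcosα⟩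
end

section
/- The only rational points on the elliptic curve E: y² = x(x² − x + 1) (equivalently y² = x³ − x² + x) over ℚ, besides the point at infinity, are (0, 0), (1, 1) and (1, −1). Equivalently: for all rational x, y with y² = x³ − x² + x, either x = 0 and y = 0, or x = 1 and y = ±1. -/
lemma isCoprime_sq_sub_sq_mul {m n : ℤ} (hmn : IsCoprime m n) :
    IsCoprime (m ^ 2 - n ^ 2) (m * n) := by
  refine IsCoprime.mul_right ?_ ?_
  · have : IsCoprime (-n ^ 2 + m * m) m :=
      IsCoprime.add_mul_left_left (IsCoprime.neg_left hmn.symm.pow_left) m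
    convert this using 1; ring
  · have : IsCoprime (m ^ 2 + n * (-n)) n :=
      IsCoprime.add_mul_left_left hmn.pow_left (-n)
    convert this using 1; ring

/-- A primitive Pythagorean triple with odd first leg, up to the sign of the hypotenuse. -/
lemma exists_primitive_pythagorean_parametrization {x y z : ℤ} (h : x ^ 2 + y ^ 2 = z ^ 2)
    (hxy : IsCoprime x y) (hx : Odd x) :
    ∃ a b : ℤ, x = a ^ 2 - b ^ 2 ∧ y = 2 * a * b ∧ IsCoprime a b := by
  have hz : 0 < |z| := by
    refine abs_pos.2 fun hz => ?_
    have : x = 0 := by subst hz; nlinarith [sq_nonneg x, sq_nonneg y]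
    subst this; simp at hx
  have ht : PythagoreanTriple x y |z| := by
    unfold PythagoreanTriple
    rw [abs_mul_abs_self]; linarith
  obtain ⟨a, b, h1, h2, -, h4, -, -⟩ := ht.coprime_classification'
    (Int.isCoprime_iff_gcd_eq_one.1 hxy) (Int.odd_iff.1 hx) hz
  exact ⟨a, b, h1, h2, Int.isCoprime_iff_gcd_eq_one.2 h4⟩

/-- Two primitive Pythagorean triples sharing the odd leg `s`, with even legs `p` and `2 * p`,
arise from a nontrivial primitive solution of `m⁴ - m²n² + n⁴ = k²` with `m` even. -/
lemma exists_legs_of_even_solution {m n k : ℤ} (hm : Even m) (hm0 : m ≠ 0) (hmn : IsCoprime m n)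
    (h : m ^ 4 - m ^ 2 * n ^ 2 + n ^ 4 = k ^ 2) :
    ∃ p q r s : ℤ, m * n = 2 * p * (q * r * s) ∧ p ≠ 0 ∧ Odd s ∧ IsCoprime s p ∧
      s ^ 2 + p ^ 2 = q ^ 2 ∧ s ^ 2 + (2 * p) ^ 2 = r ^ 2 := by
  have hn : Odd n := by
    rcases Int.even_or_odd n with hn | hn
    · have := hmn.isUnit_of_dvd' hm.two_dvd hn.two_dvd
      norm_num [Int.isUnit_iff] at this
    · exact hn
  obtain ⟨a, b, h1, h2, hab⟩ := exists_primitive_pythagorean_parametrization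
    (x := m ^ 2 - n ^ 2) (y := m * n) (z := k) (by linear_combination h)
    (isCoprime_sq_sub_sq_mul hmn) ((hm.pow_of_ne_zero two_ne_zero).sub_odd hn.pow)
  obtain ⟨m', rfl⟩ := hm.two_dvd
  have h3 : m' * n = a * b := by linarith
  obtain ⟨p, q, ⟨r, rfl⟩, ⟨s, rfl⟩, rfl⟩ := exists_dvd_and_dvd_of_dvd_mul (Dvd.intro _ h3)
  have hpq : p * q ≠ 0 := by rintro h0; simp [h0] at hm0
  have hp : p ≠ 0 := left_ne_zero_of_mul hpq
  have hq : q ≠ 0 := right_ne_zero_of_mul hpq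
  obtain rfl : n = r * s := mul_left_cancel₀ hpq (by linear_combination h3)
  have hr : Odd r := (Int.odd_mul.1 hn).1
  have hs : Odd s := (Int.odd_mul.1 hn).2
  have hps : IsCoprime p s := (hmn.of_mul_left_right.of_mul_left_left).of_mul_right_right
  have hqr : IsCoprime q r := (hmn.of_mul_left_right.of_mul_left_right).of_mul_right_left
  have h4 : p ^ 2 * (4 * q ^ 2 - r ^ 2) = s ^ 2 * (r ^ 2 - q ^ 2) := by linear_combination h1
  obtain ⟨t, ht⟩ : p ^ 2 ∣ r ^ 2 - q ^ 2 :=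
    (hps.pow (m := 2) (n := 2)).dvd_of_dvd_mul_left (Dvd.intro _ h4)
  have ht' : 4 * q ^ 2 - r ^ 2 = s ^ 2 * t :=
    mul_left_cancel₀ (pow_ne_zero 2 hp) (by rw [h4, ht]; ring)
  have ht3 : t ∣ 3 := by
    obtain ⟨c, d, hcd⟩ := hqr.pow (m := 2) (n := 2)
    exact ⟨c * (p ^ 2 + s ^ 2) + d * (4 * p ^ 2 + s ^ 2), by
      linear_combination (-3) * hcd + (c + 4 * d) * ht + (c + d) * ht'⟩
  have hpos : 0 < q ^ 2 := by positivity
  have ht0 : 0 < t := by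
    by_contra! hneg
    nlinarith [mul_nonneg (add_nonneg (sq_nonneg p) (sq_nonneg s)) (neg_nonneg.2 hneg)]
  have htle := Int.le_of_dvd (by norm_num) ht3
  obtain rfl : t = 3 := by
    interval_cases t
    · exfalso
      obtain ⟨i, rfl⟩ := hr
      obtain ⟨j, rfl⟩ := hs
      ring_nf at ht'
      omega
    · norm_num at ht3
    · rfl
  exact ⟨p, q, r, s, by ring, hp, hs, hps.symm, by linarith, by linarith⟩

lemma eq_zero_of_even_of_quartic_eq_sq {m n k : ℤ} (hm : Even m) (hmn : IsCoprime m n)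
    (h : m ^ 4 - m ^ 2 * n ^ 2 + n ^ 4 = k ^ 2) : m = 0 := by
  induction hN : (m * n).natAbs using Nat.strong_induction_on generalizing m n k with
  | _ N ih =>
  by_contra hm0
  obtain ⟨p, q, r, s, hprod, hp, hs, hsp, hq, hr⟩ := exists_legs_of_even_solution hm hm0 hmn h
  obtain ⟨u, v, hu, hv, -⟩ := exists_primitive_pythagorean_parametrization hq hsp hs
  have hs2 : IsCoprime s 2 := by
    obtain ⟨j, rfl⟩ := hs
    exact ⟨1, -j, by ring⟩
  obtain ⟨e, f, he, hf, hef⟩ :=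
    exists_primitive_pythagorean_parametrization hr (hs2.mul_right hsp) hs
  have hpef : p = e * f := by linarith
  have hlt : (e * f).natAbs < N := by
    have hs0 : s ≠ 0 := by rintro rfl; simp at hs
    have hq0 : q ≠ 0 := by rintro rfl; nlinarith [pow_pos (abs_pos.2 hs0) 2, sq_abs s, sq_nonneg p]
    have hr0 : r ≠ 0 := by
      rintro rfl; nlinarith [pow_pos (abs_pos.2 hs0) 2, sq_abs s, sq_nonneg p]
    rw [← hN, hprod, ← hpef, Int.natAbs_mul, Int.natAbs_mul]
    have h1 : 0 < p.natAbs := Int.natAbs_pos.2 hp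
    have h2 : 0 < (q * r * s).natAbs :=
      Int.natAbs_pos.2 (mul_ne_zero (mul_ne_zero hq0 hr0) hs0)
    rw [show Int.natAbs 2 = 2 from rfl]
    nlinarith
  have hquartic : e ^ 4 - e ^ 2 * f ^ 2 + f ^ 4 = q ^ 2 := by
    rw [← hq, hpef, he]; ring
  have heven : Even (e * f) := ⟨u * v, by rw [← hpef, hv]; ring⟩
  rcases Int.even_mul.1 heven with h2 | h2
  · exact hp (by rw [hpef, ih _ hlt h2 hef hquartic rfl, zero_mul])
  · exact hp (by
      rw [hpef, ih _ (by rwa [mul_comm]) h2 hef.symm (k := q) (by linarith) rfl, mul_zero])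

lemma sq_eq_sq_of_odd_of_quartic_eq_sq {m n k : ℤ} (hm : Odd m) (hn : Odd n)
    (hmn : IsCoprime m n) (h : m ^ 4 - m ^ 2 * n ^ 2 + n ^ 4 = k ^ 2) : m ^ 2 = n ^ 2 := by
  have hodd : Odd (m * n) := hm.mul hn
  obtain ⟨a, b, h1, h2, hab⟩ := exists_primitive_pythagorean_parametrization
    (x := m * n) (y := m ^ 2 - n ^ 2) (z := k) (by linear_combination h)
    (isCoprime_sq_sub_sq_mul hmn).symm hodd
  obtain ⟨c, hc⟩ : Even (m ^ 2 + n ^ 2) := hm.pow.add_odd hn.pow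
  have hquartic : a ^ 4 - a ^ 2 * b ^ 2 + b ^ 4 = c ^ 2 := by
    have h3 : 4 * (m * n) ^ 2 + (m ^ 2 - n ^ 2) ^ 2 = (m ^ 2 + n ^ 2) ^ 2 := by ring
    rw [h1, h2, hc] at h3
    linarith
  have heven : Even a ∨ Even b := by
    by_contra! hcon
    rw [Int.not_even_iff_odd, Int.not_even_iff_odd] at hcon
    rw [h1, ← Int.not_even_iff_odd] at hodd
    exact hodd (hcon.1.pow.sub_odd hcon.2.pow)
  rcases heven with h3 | h3
  · rw [eq_zero_of_even_of_quartic_eq_sq h3 hab hquartic] at h2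
    linarith
  · rw [eq_zero_of_even_of_quartic_eq_sq h3 hab.symm (k := c) (by linarith)] at h2
    linarith

lemma exists_sq_eq_of_isCoprime_of_mul_eq_sq {a b c : ℤ} (hab : IsCoprime a b) (ha : 0 ≤ a)
    (h : a * b = c ^ 2) : ∃ d, a = d ^ 2 := by
  obtain ⟨d, hd | hd⟩ := Int.sq_of_isCoprime hab h
  · exact ⟨d, hd⟩
  · exact ⟨0, by nlinarith [sq_nonneg d]⟩

/-- the only affine rational points on `y² = x³ − x² + x`
are `(0, 0)` and `(1, ±1)`. -/
theorem rational_points_of_x_cubed_sub_x_sq_add_x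
    (x y : ℚ) (h : y ^ 2 = x ^ 3 - x ^ 2 + x) :
    (x = 0 ∧ y = 0) ∨ (x = 1 ∧ (y = 1 ∨ y = -1)) := by
  by_cases hx0 : x = 0
  · subst hx0
    exact Or.inl ⟨rfl, by simpa using h⟩
  suffices hx : x = 1 by
    subst hx
    exact Or.inr ⟨rfl, sq_eq_one_iff.1 (by linarith)⟩
  have hxpos : 0 < x := by
    have h1 : 0 < x ^ 2 - x + 1 := by nlinarith [sq_nonneg (2 * x - 1)]
    have h2 : 0 ≤ x * (x ^ 2 - x + 1) := by nlinarith [sq_nonneg y]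
    exact lt_of_le_of_ne (nonneg_of_mul_nonneg_left h2 h1) (Ne.symm hx0)
  obtain ⟨A, hA⟩ : ∃ A, A = x.num := ⟨_, rfl⟩
  obtain ⟨B, hB⟩ : ∃ B : ℤ, B = x.den := ⟨_, rfl⟩
  have hApos : 0 < A := hA ▸ Rat.num_pos.2 hxpos
  have hBpos : 0 < B := by rw [hB]; exact_mod_cast x.den_pos
  have hAB : IsCoprime A B := by
    rw [hA, hB, Int.isCoprime_iff_gcd_eq_one]; exact x.reduced
  have hBne : (B : ℚ) ≠ 0 := by exact_mod_cast hBpos.ne'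
  have hxAB : x = A / B := by rw [hA, hB]; exact_mod_cast (Rat.num_div_den x).symm
  obtain ⟨w, hw⟩ : IsSquare (A * B * (A ^ 2 - A * B + B ^ 2)) := by
    rw [← Rat.isSquare_intCast_iff]
    refine ⟨y * B ^ 2, ?_⟩
    have : y * B ^ 2 * (y * B ^ 2) = y ^ 2 * B ^ 4 := by ring
    rw [this, h, hxAB]
    push_cast
    field_simp
  rw [← sq] at hw
  have hcop : IsCoprime (A * B) (A ^ 2 - A * B + B ^ 2) := by
    refine IsCoprime.mul_left ?_ ?_
    · have : IsCoprime A (B ^ 2 + A * (A - B)) := hAB.pow_right.add_mul_left_right _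
      rwa [show A ^ 2 - A * B + B ^ 2 = B ^ 2 + A * (A - B) by ring]
    · have : IsCoprime B (A ^ 2 + B * (B - A)) := hAB.symm.pow_right.add_mul_left_right _
      rwa [show A ^ 2 - A * B + B ^ 2 = A ^ 2 + B * (B - A) by ring]
  have hquad : 0 ≤ A ^ 2 - A * B + B ^ 2 := by nlinarith [sq_nonneg (A - B), mul_pos hApos hBpos]
  obtain ⟨l, hl⟩ := exists_sq_eq_of_isCoprime_of_mul_eq_sq hcop (mul_pos hApos hBpos).le hw
  obtain ⟨k, hk⟩ := exists_sq_eq_of_isCoprime_of_mul_eq_sq hcop.symm hquad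
    (by rw [mul_comm]; exact hw)
  obtain ⟨m, rfl⟩ := exists_sq_eq_of_isCoprime_of_mul_eq_sq hAB hApos.le hl
  obtain ⟨n, rfl⟩ := exists_sq_eq_of_isCoprime_of_mul_eq_sq hAB.symm hBpos.le
    (by rw [mul_comm]; exact hl)
  have hmn : IsCoprime m n := (IsCoprime.pow_iff two_pos two_pos).1 hAB
  have heq : m ^ 2 = n ^ 2 := by
    rcases Int.even_or_odd m with hm | hm
    · rw [eq_zero_of_even_of_quartic_eq_sq hm hmn (k := k) (by linarith)] at hApos
      simp at hApos
    rcases Int.even_or_odd n with hn | hn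
    · rw [eq_zero_of_even_of_quartic_eq_sq hn hmn.symm (k := k) (by linarith)] at hBpos
      simp at hBpos
    exact sq_eq_sq_of_odd_of_quartic_eq_sq hm hn hmn (k := k) (by linarith)
  rw [hxAB, heq, div_self hBne]
end

section
/- Every rational solution (u, v) of the quartic equation v² = −u⁴ + 2u² + 3 satisfies u = 1 or u = −1 (and hence v = 2 or v = −2). -/
theorem three_dvd_of_three_dvd_sq_add_sq {x y : ℤ} (h : 3 ∣ x ^ 2 + y ^ 2) : 3 ∣ x ∧ 3 ∣ y := by
  have hx : x % 3 = 0 ∨ x % 3 = 1 ∨ x % 3 = 2 := by omega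
  have hy : y % 3 = 0 ∨ y % 3 = 1 ∨ y % 3 = 2 := by omega
  rcases hx with hx | hx | hx <;> rcases hy with hy | hy | hy <;>
    simp [Int.dvd_iff_emod_eq_zero, pow_two, Int.add_emod, Int.mul_emod, hx, hy] at h ⊢

theorem sq_emod_eight_of_odd {x : ℤ} (h : x % 2 = 1) : x ^ 2 % 8 = 1 := by
  have hx : x % 8 = 1 ∨ x % 8 = 3 ∨ x % 8 = 5 ∨ x % 8 = 7 := by omega
  rcases hx with hx | hx | hx | hx <;> simp [pow_two, Int.mul_emod, hx]

theorem even_of_sq_emod_four_ne_one {x : ℤ} (h : x ^ 2 % 4 ≠ 1) : x % 2 = 0 := by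
  rcases Int.emod_two_eq_zero_or_one x with hx | hx
  · exact hx
  · have := sq_emod_eight_of_odd hx
    omega

theorem not_both_even_of_isCoprime {x y : ℤ} (h : IsCoprime x y) : ¬ (x % 2 = 0 ∧ y % 2 = 0) := by
  rintro ⟨hx, hy⟩
  have := h.isUnit_of_dvd' (Int.dvd_of_emod_eq_zero hx) (Int.dvd_of_emod_eq_zero hy)
  norm_num [Int.isUnit_iff] at this

/-- If `r * s = m * n` and `(3 * r) ^ 2 + s ^ 2 = m ^ 2 + n ^ 2`, then some factor `e` of `m * n`
solves the system `x ^ 2 = e ^ 2 + f ^ 2 = 9 * e ^ 2 + g ^ 2`. -/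
theorem exists_descent_of_mul_eq_three_mul {m n r s : ℤ} (hmn : IsCoprime m n)
    (hrs : IsCoprime (3 * r) s) (h0 : m * n ≠ 0) (hmul : r * s = m * n)
    (hsq : (3 * r) ^ 2 + s ^ 2 = m ^ 2 + n ^ 2) :
    ∃ x e f g : ℤ, IsCoprime x e ∧ x ^ 2 = e ^ 2 + f ^ 2 ∧ x ^ 2 = 9 * e ^ 2 + g ^ 2 ∧
      e ∣ m * n := by
  obtain ⟨a, b, ⟨c, rfl⟩, ⟨d, rfl⟩, rfl⟩ := exists_dvd_and_dvd_of_dvd_mul (Dvd.intro s hmul)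
  have ha : a ≠ 0 := by rintro rfl; simp at h0
  have hb : b ≠ 0 := by rintro rfl; simp at h0
  obtain rfl : s = c * d := by
    apply mul_left_cancel₀ (mul_ne_zero ha hb)
    linear_combination hmul
  have hcb : IsCoprime c b := hmn.of_mul_left_right.of_mul_right_left
  have had : IsCoprime a d := hmn.of_mul_left_left.of_mul_right_right
  have hcd : IsCoprime (3 : ℤ) (c * d) := hrs.of_mul_left_left
  have key : a ^ 2 * (9 * b ^ 2 - c ^ 2) = d ^ 2 * (b ^ 2 - c ^ 2) := by linear_combination hsq
  obtain ⟨k, hk⟩ : a ^ 2 ∣ b ^ 2 - c ^ 2 :=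
    (had.pow (m := 2) (n := 2)).dvd_of_dvd_mul_left ⟨_, key.symm⟩
  have hk' : 9 * b ^ 2 - c ^ 2 = k * d ^ 2 := by
    apply mul_left_cancel₀ (pow_ne_zero 2 ha)
    rw [key, hk]; ring
  have hk8 : k ∣ 8 := by
    obtain ⟨i, j, hij⟩ := hcb.pow (m := 2) (n := 2)
    refine ⟨i * (d ^ 2 - 9 * a ^ 2) + j * (d ^ 2 - a ^ 2), ?_⟩
    linear_combination (-8) * hij + (i + j) * hk' - (9 * i + j) * hk
  have h3 : ¬ (3 : ℤ) ∣ c ^ 2 + d ^ 2 := by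
    intro h
    have := hcd.isUnit_of_dvd' dvd_rfl (Dvd.dvd.mul_right (three_dvd_of_three_dvd_sq_add_sq h).1 d)
    norm_num [Int.isUnit_iff] at this
  have hpar : k = 2 ∨ k = -2 ∨ k = 4 ∨ k = -4 → False := by
    intro h
    have hb1 : b % 2 = 1 := by
      by_contra hb0
      have hb0 : b % 2 = 0 := by omega
      refine not_both_even_of_isCoprime hcb ⟨even_of_sq_emod_four_ne_one ?_, hb0⟩
      obtain ⟨t, rfl⟩ := Int.dvd_of_emod_eq_zero hb0
      ring_nf at hk ⊢
      rcases h with rfl | rfl | rfl | rfl <;> omega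
    have hc1 : c % 2 = 1 := by
      by_contra hc0
      have hc0 : c % 2 = 0 := by omega
      obtain ⟨t, rfl⟩ := Int.dvd_of_emod_eq_zero hc0
      have := sq_emod_eight_of_odd hb1
      ring_nf at hk
      rcases h with rfl | rfl | rfl | rfl <;> omega
    have hb2 := sq_emod_eight_of_odd hb1
    have hc2 := sq_emod_eight_of_odd hc1
    refine not_both_even_of_isCoprime had
      ⟨even_of_sq_emod_four_ne_one ?_, even_of_sq_emod_four_ne_one ?_⟩ <;>
    rcases h with rfl | rfl | rfl | rfl <;> omega
  have hle : k ≤ 8 := Int.le_of_dvd (by norm_num) hk8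
  have hge : -8 ≤ k := by
    have := Int.le_of_dvd (by norm_num) ((neg_dvd).mpr hk8)
    linarith
  interval_cases k <;> try (exfalso; revert hk8; decide)
  · exact (h3 ⟨3 * a ^ 2, by linarith⟩).elim
  · exact (hpar (by norm_num)).elim
  · exact (hpar (by norm_num)).elim
  · exact ⟨c, b, a, d, hcb, by linarith, by linarith, ⟨a * c * d, by ring⟩⟩
  · exact (h3 ⟨3 * b ^ 2, by linarith⟩).elim
  · exact (hpar (by norm_num)).elim
  · exact (hpar (by norm_num)).elim
  · exact ⟨d, a, b, c, had.symm, by linarith, by linarith, ⟨b * c * d, by ring⟩⟩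

theorem eq_zero_of_sq_eq_sq_add_sq_of_sq_eq_nine_mul_sq_add_sq {x e f g : ℤ}
    (hxe : IsCoprime x e) (hf : x ^ 2 = e ^ 2 + f ^ 2) (hg : x ^ 2 = 9 * e ^ 2 + g ^ 2) :
    e = 0 := by
  induction hN : e.natAbs using Nat.strong_induction_on generalizing x e f g with
  | _ N ih =>
  by_contra he
  wlog hx : 0 < x generalizing x
  · have hx0 : x ≠ 0 := by
      rintro rfl
      have : 0 < e ^ 2 := by positivity
      nlinarith [sq_nonneg f]
    exact this (x := -x) hxe.neg_left (by linarith) (by linarith) (by omega)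
  have hee : e % 2 = 0 := by
    by_contra h
    have he2 := sq_emod_eight_of_odd (x := e) (by omega)
    have hf0 : f % 2 = 0 := by
      by_contra h
      have hf2 := sq_emod_eight_of_odd (x := f) (by omega)
      rcases Int.emod_two_eq_zero_or_one x with hx | hx
      · obtain ⟨t, rfl⟩ := Int.dvd_of_emod_eq_zero hx
        ring_nf at hf
        omega
      · have := sq_emod_eight_of_odd hx
        omega
    have hg0 : g % 2 = 0 := by
      apply even_of_sq_emod_four_ne_one
      obtain ⟨t, rfl⟩ := Int.dvd_of_emod_eq_zero hf0
      ring_nf at hf hg ⊢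
      omega
    obtain ⟨t, rfl⟩ := Int.dvd_of_emod_eq_zero hf0
    obtain ⟨w, rfl⟩ := Int.dvd_of_emod_eq_zero hg0
    have htw : t ^ 2 - w ^ 2 = 2 * e ^ 2 := by linarith
    rcases Int.emod_two_eq_zero_or_one t with ht | ht <;>
      rcases Int.emod_two_eq_zero_or_one w with hw | hw
    · obtain ⟨t, rfl⟩ := Int.dvd_of_emod_eq_zero ht
      obtain ⟨w, rfl⟩ := Int.dvd_of_emod_eq_zero hw
      ring_nf at htw
      omega
    · have := sq_emod_eight_of_odd hw
      obtain ⟨t, rfl⟩ := Int.dvd_of_emod_eq_zero ht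
      ring_nf at htw
      omega
    · have := sq_emod_eight_of_odd ht
      obtain ⟨w, rfl⟩ := Int.dvd_of_emod_eq_zero hw
      ring_nf at htw
      omega
    · have := sq_emod_eight_of_odd ht
      have := sq_emod_eight_of_odd hw
      omega
  have hx1 : x % 2 = 1 := by
    have := not_both_even_of_isCoprime hxe
    omega
  have hodd : ∀ {c y : ℤ}, x ^ 2 = c * e ^ 2 + y ^ 2 → y % 2 = 1 := by
    intro c y hy
    by_contra h
    have hy0 : y % 2 = 0 := by omega
    obtain ⟨t, rfl⟩ := Int.dvd_of_emod_eq_zero hy0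
    obtain ⟨w, rfl⟩ := Int.dvd_of_emod_eq_zero hee
    have := sq_emod_eight_of_odd hx1
    have : x ^ 2 = 4 * (c * w ^ 2 + t ^ 2) := by linear_combination hy
    omega
  have hfe : IsCoprime f e := by
    have : IsCoprime (f ^ 2) (e ^ 2) := by
      have h := hxe.pow (m := 2) (n := 2)
      rw [hf] at h
      simpa using (IsCoprime.add_mul_right_left_iff (z := 1)).mp (by simpa [add_comm] using h)
    exact (IsCoprime.pow_iff two_pos two_pos).mp this
  have h3x : IsCoprime (3 : ℤ) x := by
    refine (Int.prime_three.coprime_iff_not_dvd).mpr fun h => ?_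
    have h3 := three_dvd_of_three_dvd_sq_add_sq (hf ▸ dvd_pow h two_ne_zero)
    have := hxe.isUnit_of_dvd' h h3.1
    norm_num [Int.isUnit_iff] at this
  have hge : IsCoprime g (3 * e) := by
    have : IsCoprime (g ^ 2) ((3 * e) ^ 2) := by
      have h := (h3x.symm.mul_right hxe).pow (m := 2) (n := 2)
      rw [show x ^ 2 = g ^ 2 + (3 * e) ^ 2 * 1 by linarith] at h
      exact (IsCoprime.add_mul_left_left_iff).mp h
    exact (IsCoprime.pow_iff two_pos two_pos).mp this
  obtain ⟨m, n, -, hmn, hxmn, hc, -, -⟩ := PythagoreanTriple.coprime_classification'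
    (x := f) (y := e) (z := x) (by unfold PythagoreanTriple; linarith)
    (Int.isCoprime_iff_gcd_eq_one.mp hfe) (hodd (c := 1) (by linarith)) hx
  obtain ⟨r, s, -, hrs, hxrs, hc', -, -⟩ := PythagoreanTriple.coprime_classification'
    (x := g) (y := 3 * e) (z := x) (by unfold PythagoreanTriple; linarith)
    (Int.isCoprime_iff_gcd_eq_one.mp hge) (hodd hg) hx
  rw [← Int.isCoprime_iff_gcd_eq_one] at hc hc'
  have h0 : m * n ≠ 0 := by
    intro h
    apply he
    linear_combination hmn + 2 * h
  have hdesc : ∃ x e f g : ℤ, IsCoprime x e ∧ x ^ 2 = e ^ 2 + f ^ 2 ∧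
      x ^ 2 = 9 * e ^ 2 + g ^ 2 ∧ e ∣ m * n := by
    have hprod : r * s = 3 * (m * n) := by linarith
    rcases Int.prime_three.dvd_or_dvd (Dvd.intro _ hprod.symm) with ⟨t, rfl⟩ | ⟨t, rfl⟩
    · exact exists_descent_of_mul_eq_three_mul hc hc' h0 (by linarith) (by linarith)
    · exact exists_descent_of_mul_eq_three_mul hc hc'.symm h0 (by linarith) (by linarith)
  obtain ⟨x', e', f', g', hxe', hf', hg', hdvd⟩ := hdesc
  have hlt : e'.natAbs < N := by
    have h1 := Nat.le_of_dvd (Int.natAbs_pos.mpr h0) (Int.natAbs_dvd_natAbs.mpr hdvd)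
    have h2 : e = 2 * (m * n) := by linarith
    omega
  obtain rfl := ih _ hlt hxe' hf' hg' rfl
  exact h0 (zero_dvd_iff.mp hdvd)

theorem exists_sq_of_isCoprime_of_mul_eq_sq {a b c : ℤ} (hab : IsCoprime a b)
    (habc : a * b = c ^ 2) (hb : 0 < b) : (∃ y, a = y ^ 2) ∧ ∃ z, b = z ^ 2 := by
  have ha : 0 ≤ a := nonneg_of_mul_nonneg_left (habc ▸ sq_nonneg c) hb
  obtain ⟨y, hy | hy⟩ := Int.sq_of_isCoprime hab habc
  · obtain ⟨z, hz | hz⟩ := Int.sq_of_isCoprime hab.symm ((mul_comm b a).trans habc)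
    · exact ⟨⟨y, hy⟩, z, hz⟩
    · nlinarith [sq_nonneg z]
  · obtain ⟨z, hz | hz⟩ := Int.sq_of_isCoprime hab.symm ((mul_comm b a).trans habc)
    · exact ⟨⟨0, by nlinarith [sq_nonneg y]⟩, z, hz⟩
    · nlinarith [sq_nonneg z]

theorem sq_eq_sq_of_sq_eq_mul {p q w : ℤ} (hq : q ≠ 0) (hpq : IsCoprime p q)
    (h : w ^ 2 = (3 * q ^ 2 - p ^ 2) * (p ^ 2 + q ^ 2)) : p ^ 2 = q ^ 2 := by
  have hpos : 0 < p ^ 2 + q ^ 2 := by positivity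
  obtain ⟨i, j, hij⟩ := hpq.pow (m := 2) (n := 2)
  by_cases hpar : p % 2 = 1 ∧ q % 2 = 1
  · have hp := sq_emod_eight_of_odd hpar.1
    have hq := sq_emod_eight_of_odd hpar.2
    obtain ⟨b, hb⟩ : ∃ b, p ^ 2 + q ^ 2 = 2 * b := ⟨(p ^ 2 + q ^ 2) / 2, by omega⟩
    obtain ⟨a, ha⟩ : ∃ a, 3 * q ^ 2 - p ^ 2 = 2 * a := ⟨(3 * q ^ 2 - p ^ 2) / 2, by omega⟩
    have hodd : b % 2 = 1 := by omega
    obtain ⟨t, ht⟩ : ∃ t, b = 2 * t + 1 := ⟨b / 2, by omega⟩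
    rw [ha, hb] at h
    have hw : w % 2 = 0 := by
      apply even_of_sq_emod_four_ne_one
      have : w ^ 2 = 4 * (a * b) := by linarith
      omega
    obtain ⟨y, rfl⟩ := Int.dvd_of_emod_eq_zero hw
    have hab : IsCoprime a b := by
      refine ⟨-t * (j - i), 1 - t * (3 * i + j), ?_⟩
      have hq2 : a + b = 2 * q ^ 2 := by linarith
      have hp2 : 3 * b - a = 2 * p ^ 2 := by linarith
      linear_combination ht - 2 * t * hij - t * j * hq2 - t * i * hp2
    obtain ⟨⟨c, rfl⟩, d, rfl⟩ := exists_sq_of_isCoprime_of_mul_eq_sq hab (c := y) (by linarith) (by linarith)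
    have hqd : IsCoprime (d ^ 2) (q ^ 2) :=
      ⟨2 * i, j - i, by linear_combination hij - i * hb⟩
    obtain ⟨e, he⟩ : ∃ e, d ^ 2 - q ^ 2 = 2 * e := ⟨(d ^ 2 - q ^ 2) / 2, by omega⟩
    have hc : c ^ 2 = q ^ 2 - 2 * e := by linarith
    have hp' : p ^ 2 = q ^ 2 + 4 * e := by linarith
    have hxe : IsCoprime (q ^ 2 + e) e := by
      obtain ⟨i', j', hij'⟩ := hqd
      exact ⟨i' + j', i' - j', by linear_combination hij' - i' * he⟩
    have he0 := eq_zero_of_sq_eq_sq_add_sq_of_sq_eq_nine_mul_sq_add_sq (f := d * q) (g := c * p)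
      hxe (by linear_combination -q ^ 2 * he)
      (by linear_combination (-p ^ 2) * hc - (q ^ 2 - 2 * e) * hp')
    subst he0
    linarith
  · exfalso
    have hne := not_both_even_of_isCoprime hpq
    have hodd : (p ^ 2 + q ^ 2) % 2 = 1 := by
      have : (p + q) % 2 = 1 := by omega
      rw [← Int.odd_iff] at this ⊢
      simpa [Int.odd_add, Int.odd_pow, Int.even_pow] using this
    obtain ⟨t, ht⟩ : ∃ t, p ^ 2 + q ^ 2 = 2 * t + 1 := ⟨(p ^ 2 + q ^ 2) / 2, by omega⟩
    have hcop : IsCoprime (3 * q ^ 2 - p ^ 2) (p ^ 2 + q ^ 2) := by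
      refine ⟨t ^ 2 * (j - i), t ^ 2 * (3 * i + j) - (p ^ 2 + q ^ 2 - 2), ?_⟩
      linear_combination 4 * t ^ 2 * hij - (p ^ 2 + q ^ 2 + 2 * t - 1) * ht
    obtain ⟨⟨y, hy⟩, -⟩ := exists_sq_of_isCoprime_of_mul_eq_sq hcop h.symm hpos
    have h3 := three_dvd_of_three_dvd_sq_add_sq (x := y) (y := p) ⟨q ^ 2, by linarith⟩
    obtain ⟨⟨y, rfl⟩, p, rfl⟩ := h3
    have h3q : (3 : ℤ) ∣ q := Int.prime_three.dvd_of_dvd_pow (n := 2) ⟨y ^ 2 + p ^ 2, by linarith⟩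
    have := hpq.isUnit_of_dvd' (Dvd.intro p rfl) h3q
    norm_num [Int.isUnit_iff] at this

/-- every rational solution of `v² = −u⁴ + 2u² + 3`
has `u = ±1` (and hence `v = ±2`). -/
theorem rational_points_quartic_equilateral
    (u v : ℚ) (h : v ^ 2 = -u ^ 4 + 2 * u ^ 2 + 3) :
    (u = 1 ∨ u = -1) ∧ (v = 2 ∨ v = -2) := by
  have hq : (u.den : ℚ) ≠ 0 := by exact_mod_cast u.den_nz
  have hu : u * u.den = u.num := Rat.mul_den_eq_num u
  have hsq : (v * u.den ^ 2) ^ 2 =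
      (((3 * (u.den : ℤ) ^ 2 - u.num ^ 2) * (u.num ^ 2 + (u.den : ℤ) ^ 2) : ℤ) : ℚ) := by
    push_cast
    rw [← hu]
    linear_combination (u.den : ℚ) ^ 4 * h
  obtain ⟨w, hw⟩ : ∃ w : ℤ, (w : ℚ) = v * u.den ^ 2 := by
    have : IsIntegral ℤ (v * (u.den : ℚ) ^ 2) := by
      refine IsIntegral.of_pow two_pos ?_
      rw [hsq]
      exact isIntegral_algebraMap
    obtain ⟨w, hw⟩ := IsIntegrallyClosed.isIntegral_iff.mp this
    exact ⟨w, by simpa using hw⟩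
  rw [← hw] at hsq
  have hpq := sq_eq_sq_of_sq_eq_mul (p := u.num) (q := u.den) (by exact_mod_cast u.den_nz)
    u.isCoprime_num_den (by exact_mod_cast hsq)
  have hu2 : u ^ 2 = 1 := by
    apply mul_right_cancel₀ (pow_ne_zero 2 hq)
    rw [← mul_pow, hu, one_mul]
    exact_mod_cast hpq
  refine ⟨(by simpa using hu2), sq_eq_sq_iff_eq_or_eq_neg.mp ?_⟩
  linear_combination h + (1 - u ^ 2) * hu2
end

section
/- Let a ∈ (0, 2π/3) and m ∈ (0, π) be real numbers satisfying the spherical Pythagorean relation cos m · cos(a/2) = cos a (so that m is the length of a median of an equilateral spherical triangle of side length a). If cos a, sin a, cos m and sin m are all rational, then a = π/2 and m = π/2. That is, the only equilateral spherical triangle with rational sides and rational medians is the one with a = π/2, whose angles are also π/2. -/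
open Real

theorem Nat.sq_add_sq_ne_three_mul_sq (x y : ℕ) {z : ℕ} (hz : z ≠ 0) :
    x ^ 2 + y ^ 2 ≠ 3 * z ^ 2 := by
  intro h
  have : Fact (Nat.Prime 3) := ⟨Nat.prime_three⟩
  have heven : Even (padicValNat 3 (3 * z ^ 2)) :=
    Nat.eq_sq_add_sq_iff.mp ⟨x, y, h.symm⟩ 3 (by simp [hz, Nat.prime_three]) (by norm_num)
  rw [padicValNat.mul (by norm_num) (by positivity), padicValNat.self (by norm_num),
    padicValNat.pow] at heven
  grind

theorem Rat.sq_add_sq_ne_three (x y : ℚ) : x ^ 2 + y ^ 2 ≠ 3 := by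
  intro h
  apply Nat.sq_add_sq_ne_three_mul_sq (x.num.natAbs * y.den) (y.num.natAbs * x.den)
    (mul_ne_zero x.den_ne_zero y.den_ne_zero)
  have hx : (x.den : ℚ) ≠ 0 := by exact_mod_cast x.den_ne_zero
  have hy : (y.den : ℚ) ≠ 0 := by exact_mod_cast y.den_ne_zero
  rw [← Rat.num_div_den x, ← Rat.num_div_den y] at h
  field_simp at h
  zify
  simp only [mul_pow, sq_abs]
  have h' : (x.num : ℚ) ^ 2 * y.den ^ 2 + y.num ^ 2 * x.den ^ 2
      = 3 * (x.den ^ 2 * y.den ^ 2) := by linear_combination h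
  exact_mod_cast h'

/-- the only equilateral spherical triangle with rational sides and
rational medians has side `a = π/2` and median `m = π/2`. -/
theorem equilateral_rational_sides_medians
    (a m : ℝ) (ha0 : 0 < a) (ha : a < 2 * π / 3) (hm0 : 0 < m) (hmπ : m < π)
    (hlaw : Real.cos m * Real.cos (a / 2) = Real.cos a)
    (hca : ∃ q : ℚ, (q : ℝ) = Real.cos a)
    (hsa : ∃ q : ℚ, (q : ℝ) = Real.sin a)
    (hcm : ∃ q : ℚ, (q : ℝ) = Real.cos m)
    (hsm : ∃ q : ℚ, (q : ℝ) = Real.sin m) :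
    a = π / 2 ∧ m = π / 2 := by
  obtain ⟨p, hp⟩ := hca
  obtain ⟨q, hq⟩ := hsa
  obtain ⟨u, hu⟩ := hcm
  obtain ⟨v, hv⟩ := hsm
  have hπ := Real.pi_pos
  have hc : 0 < Real.cos (a / 2) := Real.cos_pos_of_mem_Ioo ⟨by linarith, by linarith⟩
  have hs : 0 < Real.sin (a / 2) := Real.sin_pos_of_pos_of_lt_pi (by linarith) (by linarith)
  have hcos : Real.cos a = 2 * Real.cos (a / 2) ^ 2 - 1 := by
    rw [← Real.cos_two_mul]; ring_nf
  have hsin : Real.sin a = 2 * Real.sin (a / 2) * Real.cos (a / 2) := by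
    rw [← Real.sin_two_mul]; ring_nf
  have hunit := Real.sin_sq_add_cos_sq (a / 2)
  have hunit' := Real.sin_sq_add_cos_sq m
  have eq_pi_div_two : ∀ x : ℝ, 0 < x → x < π → Real.cos x = 0 → x = π / 2 := fun x h0 h1 h =>
    Real.injOn_cos ⟨h0.le, h1.le⟩ ⟨by linarith, by linarith⟩ (by rw [h, Real.cos_pi_div_two])
  by_cases hm : Real.cos m = 0
  · exact ⟨eq_pi_div_two a ha0 (by linarith) (by rw [← hlaw, hm, zero_mul]),
      eq_pi_div_two m hm0 hmπ hm⟩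
  exfalso
  set c := Real.cos (a / 2)
  set s := Real.sin (a / 2)
  have hc_eq : c = ((p / u : ℚ) : ℝ) := by
    push_cast
    rw [hp, hu, ← hlaw]
    field_simp
  have hs_eq : s = ((q / (2 * (p / u)) : ℚ) : ℝ) := by
    rw [Rat.cast_div, Rat.cast_mul, ← hc_eq, hq, hsin]
    push_cast
    field_simp
  apply Rat.sq_add_sq_ne_three (q / (2 * (p / u)) / (p / u)) (v / (q / (2 * (p / u))))
  have key : (s / c) ^ 2 + (Real.sin m / s) ^ 2 = 3 := by
    have h2 : (Real.cos m * c) ^ 2 = (2 * c ^ 2 - 1) ^ 2 := by rw [hlaw, hcos]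
    have hs2 : s ^ 2 = 1 - c ^ 2 := by linarith
    have hm2 : Real.sin m ^ 2 = 1 - Real.cos m ^ 2 := by linarith
    field_simp
    rw [show s ^ 4 = (s ^ 2) ^ 2 by ring, hs2, hm2]
    linear_combination -h2
  rw [hs_eq, hc_eq, ← hv] at key
  exact_mod_cast key
end

section
/- Let α ∈ (π/3, π) and m ∈ (0, π) be real numbers satisfying the spherical Pythagorean relation cos m · sin(α/2) = cos α (so that m is the length of a median of an equilateral spherical triangle whose angles all equal α). If cos α, sin α, cos m and sin m are all rational, then α = π/2 and m = π/2. That is, the only equilateral spherical triangle with rational angles and rational medians is the one with α = π/2, whose sides are also π/2. -/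
open Real

/-- Three times a nonzero natural square is not a sum of two squares. -/
lemma Nat.eq_zero_of_sq_add_sq_eq_three_mul_sq {x y z : ℕ} (h : x ^ 2 + y ^ 2 = 3 * z ^ 2) :
    z = 0 := by
  by_contra hz
  have h3 : Nat.Prime 3 := Nat.prime_three
  have : Fact (Nat.Prime 3) := ⟨h3⟩
  have hev := Nat.eq_sq_add_sq_iff.mp ⟨x, y, h.symm⟩
    (q := 3) (by simp [h3, hz]) (by norm_num)
  rw [padicValNat.mul (by norm_num) (by positivity), padicValNat.pow,
    padicValNat_self] at hev
  grind

/-- Three times a nonzero rational square is not a sum of two rational squares. -/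
lemma Rat.eq_zero_of_sq_add_sq_eq_three_mul_sq {x y z : ℚ} (h : x ^ 2 + y ^ 2 = 3 * z ^ 2) :
    z = 0 := by
  have hx : (x.den : ℚ) ≠ 0 := by exact_mod_cast x.den_nz
  have hy : (y.den : ℚ) ≠ 0 := by exact_mod_cast y.den_nz
  have hz : (z.den : ℚ) ≠ 0 := by exact_mod_cast z.den_nz
  have hint : (x.num * y.den * z.den) ^ 2 + (y.num * x.den * z.den) ^ 2
      = 3 * (z.num * x.den * y.den) ^ 2 := by
    rw [← Rat.num_div_den x, ← Rat.num_div_den y, ← Rat.num_div_den z] at h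
    field_simp at h
    have h' : ((x.num : ℚ) * y.den * z.den) ^ 2 + (y.num * x.den * z.den) ^ 2
      = 3 * (z.num * x.den * y.den) ^ 2 := by linear_combination h
    exact_mod_cast h'
  have hnat : (x.num * y.den * z.den).natAbs ^ 2 + (y.num * x.den * z.den).natAbs ^ 2
      = 3 * (z.num * x.den * y.den).natAbs ^ 2 := by
    zify
    simpa only [sq_abs] using hint
  simpa using Nat.eq_zero_of_sq_add_sq_eq_three_mul_sq hnat

/-- the only equilateral spherical triangle with rational angles and
rational medians has angle `α = π/2` and median `m = π/2`. -/
theorem equilateral_rational_angles_medians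
    (α m : ℝ) (hα0 : π / 3 < α) (hα : α < π) (hm0 : 0 < m) (hmπ : m < π)
    (hlaw : Real.cos m * Real.sin (α / 2) = Real.cos α)
    (hcα : ∃ q : ℚ, (q : ℝ) = Real.cos α)
    (hsα : ∃ q : ℚ, (q : ℝ) = Real.sin α)
    (hcm : ∃ q : ℚ, (q : ℝ) = Real.cos m)
    (hsm : ∃ q : ℚ, (q : ℝ) = Real.sin m) :
    α = π / 2 ∧ m = π / 2 := by
  have hpi := Real.pi_pos
  have eq_pi_div_two {x : ℝ} (h0 : 0 < x) (h1 : x < π) (hx : Real.cos x = 0) : x = π / 2 :=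
    Real.injOn_cos ⟨h0.le, h1.le⟩ ⟨by linarith, by linarith⟩ (by rw [hx, Real.cos_pi_div_two])
  have hα_pos : 0 < α := by linarith
  by_cases hc : Real.cos m = 0
  · exact ⟨eq_pi_div_two hα_pos hα (by rw [← hlaw, hc, zero_mul]), eq_pi_div_two hm0 hmπ hc⟩
  exfalso
  obtain ⟨a, ha⟩ := hcα
  obtain ⟨b, hb⟩ := hsα
  obtain ⟨c, hc'⟩ := hcm
  obtain ⟨d, hd⟩ := hsm
  have hs : Real.sin (α / 2) = a / c := by
    rw [ha, hc', ← hlaw, mul_div_cancel_left₀ _ hc]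
  have hdouble : α = 2 * (α / 2) := by ring
  have hcos : (a : ℝ) = 2 * Real.cos (α / 2) ^ 2 - 1 := by
    rw [ha, ← Real.cos_two_mul, ← hdouble]
  have hsin : (b : ℝ) = 2 * Real.sin (α / 2) * Real.cos (α / 2) := by
    rw [hb, ← Real.sin_two_mul, ← hdouble]
  have hb0 : b ≠ 0 := by
    have : (0 : ℝ) < b := hb ▸ Real.sin_pos_of_pos_of_lt_pi hα_pos hα
    exact_mod_cast this.ne'
  have hlaw' : (c : ℝ) * Real.sin (α / 2) = a := by rw [hc', hlaw, ha]
  have hm := Real.sin_sq_add_cos_sq m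
  have hα2 := Real.sin_sq_add_cos_sq (α / 2)
  rw [← hc', ← hd] at hm
  have key : ((d : ℝ) * (a / c)) ^ 2 + ((1 + a) / 2) ^ 2 = 3 * (b / 2) ^ 2 := by
    rw [← hs, hsin]
    have h1 : (1 + (a : ℝ)) / 2 = Real.cos (α / 2) ^ 2 := by rw [hcos]; ring
    rw [h1]
    generalize Real.sin (α / 2) = s at *
    generalize Real.cos (α / 2) = t at *
    have h2 : ((c : ℝ) * s) ^ 2 = (2 * t ^ 2 - 1) ^ 2 := by rw [hlaw', hcos]
    have h3 : s ^ 2 = 1 - t ^ 2 := by linarith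
    linear_combination s ^ 2 * hm - h2 + (1 - 3 * t ^ 2) * h3
  have hz := Rat.eq_zero_of_sq_add_sq_eq_three_mul_sq
    (x := d * (a / c)) (y := (1 + a) / 2) (z := b / 2) (by exact_mod_cast key)
  exact hb0 (by linarith)
end

section
/- The only affine rational points on the genus 2 curve C: Y² = X⁶ − 5X⁴ + 11X² + 1 are (0, 1) and (0, −1). Equivalently: for all rational X, Y with Y² = X⁶ − 5X⁴ + 11X² + 1, one has X = 0 and Y = ±1. -/
section Sextic

variable {a b y : ℤ}

lemma parity_of_sextic_eq_sq (hab : IsCoprime a b)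
    (hy : a ^ 6 - 5 * a ^ 4 * b ^ 2 + 11 * a ^ 2 * b ^ 4 + b ^ 6 = y ^ 2) :
    Odd a ∧ Even b ∨ Even a ∧ Odd b := by
  have key : ∀ a b y : ZMod 16, a ^ 6 - 5 * a ^ 4 * b ^ 2 + 11 * a ^ 2 * b ^ 4 + b ^ 6 = y ^ 2 →
      8 * (a * b) = 0 := by decide +kernel
  have h16 := key a b y (by exact_mod_cast congrArg (Int.cast : ℤ → ZMod 16) hy)
  have heven : Even (a * b) := by
    have : ((8 * (a * b) : ℤ) : ZMod 16) = 0 := by exact_mod_cast h16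
    rw [ZMod.intCast_zmod_eq_zero_iff_dvd] at this
    rw [even_iff_two_dvd]
    omega
  rcases Int.even_or_odd a with ha | ha <;> rcases Int.even_or_odd b with hb | hb
  · exact absurd (hab.isUnit_of_dvd' ha.two_dvd hb.two_dvd) (by decide)
  · exact .inr ⟨ha, hb⟩
  · exact .inl ⟨ha, hb⟩
  · exact absurd heven (by simp [Int.even_mul, ha, hb])

lemma isCoprime_of_sextic_eq_sq (hab : IsCoprime a b)
    (hy : a ^ 6 - 5 * a ^ 4 * b ^ 2 + 11 * a ^ 2 * b ^ 4 + b ^ 6 = y ^ 2) : IsCoprime y 22 := by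
  have h2 : IsCoprime y 2 := by
    have hodd : Odd (y ^ 2) := by
      rw [← hy]
      rcases parity_of_sextic_eq_sq hab hy with ⟨ha, hb⟩ | ⟨ha, hb⟩
      · simp [Int.odd_add, Int.odd_sub, parity_simps, ha, hb]
      · simp [Int.odd_add, Int.odd_sub, parity_simps, ha, Int.not_odd_iff_even.2 ha,
          Int.not_even_iff_odd.2 hb]
    refine (Int.prime_two.coprime_iff_not_dvd.2 fun hdvd ↦ ?_).symm
    exact Int.not_even_iff_odd.2 hodd ((even_iff_two_dvd.2 hdvd).pow_of_ne_zero two_ne_zero)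
  have h11 : IsCoprime y 11 := by
    have h11 : Prime (11 : ℤ) := Nat.prime_iff_prime_int.1 (by norm_num)
    refine (h11.coprime_iff_not_dvd.2 fun hdvd ↦ ?_).symm
    have key : ∀ a b : ZMod 11, a ^ 6 - 5 * a ^ 4 * b ^ 2 + 11 * a ^ 2 * b ^ 4 + b ^ 6 = 0 →
        a = 0 ∧ b = 0 := by decide +kernel
    have hy' := congrArg (Int.cast : ℤ → ZMod 11) hy
    push_cast at hy'
    rw [(ZMod.intCast_zmod_eq_zero_iff_dvd y 11).2 hdvd, zero_pow two_ne_zero] at hy'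
    obtain ⟨ha, hb⟩ := key a b hy'
    rw [ZMod.intCast_zmod_eq_zero_iff_dvd] at ha hb
    exact absurd (hab.isUnit_of_dvd' ha hb) (by decide)
  exact h2.mul_right h11

end Sextic

/-- The arithmetic of the ring of integers of the cubic field of discriminant `-44` that the
descent uses; `η` is a root of `x³ - x² + x + 1` and `η - 1` generates the prime above `2`. -/
structure CubicArithmetic {R : Type*} [CommRing R] (η : R) : Prop where
  cubic : η ^ 3 = η ^ 2 - η - 1
  prime_two : Prime (η - 1)
  residue : ∀ x : R, η - 1 ∣ x ∨ η - 1 ∣ x - 1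
  prime_eleven : Prime (1 - 2 * η)
  units : ∃ u₀ : Rˣ, ∀ u : Rˣ, ∃ n : ℤ, u = u₀ ^ n ∨ u = -u₀ ^ n
  real : ∃ σ : R →+* ℝ, Function.Injective σ ∧ σ η < 0

namespace CubicArithmetic

variable {R : Type*} [CommRing R] {η : R}

lemma two_eq (h : CubicArithmetic η) : (2 : R) = η * (η - 1) ^ 3 := by
  linear_combination (-η + 2) * h.cubic

lemma isUnit_eta (h : CubicArithmetic η) : IsUnit η :=
  .of_mul_eq_one (-(η ^ 2 - η + 1)) (by linear_combination -h.cubic)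

lemma isUnit_of_mem (h : CubicArithmetic η) {e : R} (he : e = 1 ∨ e = -1 ∨ e = η ∨ e = -η) :
    IsUnit e := by
  rcases he with rfl | rfl | rfl | rfl
  · exact isUnit_one
  · exact isUnit_one.neg
  · exact h.isUnit_eta
  · exact h.isUnit_eta.neg

lemma not_dvd_of_dvd_sub_one (h : CubicArithmetic η) {x : R} (hx : η - 1 ∣ x - 1) :
    ¬ η - 1 ∣ x := fun hx' ↦
  h.prime_two.not_isUnit (isUnit_of_dvd_one (by simpa using dvd_sub hx' hx))

lemma dvd_sub_one (h : CubicArithmetic η) {x : R} (hx : ¬ η - 1 ∣ x) : η - 1 ∣ x - 1 :=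
  (h.residue x).resolve_left hx

lemma dvd_two (h : CubicArithmetic η) : η - 1 ∣ 2 :=
  ⟨η * (η - 1) ^ 2, by linear_combination h.two_eq⟩

lemma dvd_sub_of_odd (h : CubicArithmetic η) {x y : R} (hx : ¬ η - 1 ∣ x) (hy : ¬ η - 1 ∣ y) :
    η - 1 ∣ x - y := by
  simpa using dvd_sub (h.dvd_sub_one hx) (h.dvd_sub_one hy)

lemma dvd_add_of_odd (h : CubicArithmetic η) {x y : R} (hx : ¬ η - 1 ∣ x) (hy : ¬ η - 1 ∣ y) :
    η - 1 ∣ x + y := by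
  have := dvd_add (h.dvd_sub_of_odd hx hy) (h.dvd_two.mul_right y)
  convert this using 1; ring

lemma not_dvd_eta (h : CubicArithmetic η) : ¬ η - 1 ∣ η :=
  fun hd ↦ h.prime_two.not_isUnit (isUnit_of_dvd_unit hd h.isUnit_eta)

lemma not_dvd_mul (h : CubicArithmetic η) {x y : R} (hx : ¬ η - 1 ∣ x) (hy : ¬ η - 1 ∣ y) :
    ¬ η - 1 ∣ x * y := fun hxy ↦ (h.prime_two.dvd_or_dvd hxy).elim hx hy

lemma sq_dvd_sq_sub_one (h : CubicArithmetic η) {x : R} (hx : ¬ η - 1 ∣ x) :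
    (η - 1) ^ 2 ∣ x ^ 2 - 1 := by
  obtain ⟨y, hy⟩ := h.dvd_sub_one hx
  refine ⟨y ^ 2 + η * (η - 1) ^ 2 * y, ?_⟩
  linear_combination (x + 1) * hy + (η - 1) * y * h.two_eq + (η - 1) * y * hy

lemma pow_dvd_two_mul (h : CubicArithmetic η) {x : R} (hx : η - 1 ∣ x) :
    (η - 1) ^ 4 ∣ 2 * x := by
  obtain ⟨y, rfl⟩ := hx
  exact ⟨η * y, by linear_combination (η - 1) * y * h.two_eq⟩

lemma odd_even_of_unit_mul (h : CubicArithmetic η) {e p q : R} (he : IsUnit e)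
    (hp : ¬ η - 1 ∣ e * p ^ 2) (hq : η - 1 ∣ e * q ^ 2) : ¬ η - 1 ∣ p ∧ η - 1 ∣ q := by
  rw [he.dvd_mul_left] at hp hq
  exact ⟨fun hh ↦ hp (dvd_pow hh two_ne_zero), h.prime_two.dvd_of_dvd_pow hq⟩

lemma isCoprime_of_mul_eq_sq {a b r s t : R} (hab : IsCoprime a b) (ha : a = s - t)
    (hst : s * t = r ^ 2) (hr : r ∣ b) : IsCoprime s t := by
  have har : IsCoprime a (r ^ 2) := (hab.of_isCoprime_of_dvd_right hr).pow_right
  rw [ha, ← hst] at har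
  obtain ⟨u, v, huv⟩ := har.of_mul_right_left
  exact ⟨u + v, -u, by linear_combination huv⟩

lemma dvd_intCast_of_even (h : CubicArithmetic η) {a : ℤ} (ha : Even a) : η - 1 ∣ (a : R) := by
  obtain ⟨k, rfl⟩ := ha
  push_cast
  rw [← two_mul]
  exact h.dvd_two.mul_right _

lemma not_dvd_intCast_of_odd (h : CubicArithmetic η) {a : ℤ} (ha : Odd a) :
    ¬ η - 1 ∣ (a : R) := by
  obtain ⟨k, rfl⟩ := ha
  exact h.not_dvd_of_dvd_sub_one (by simpa using h.dvd_two.mul_right (k : R))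

lemma pow_dvd_intCast_sq_of_even (h : CubicArithmetic η) {a : ℤ} (ha : Even a) :
    (η - 1) ^ 4 ∣ (a : R) ^ 2 := by
  obtain ⟨k, rfl⟩ := ha
  push_cast
  convert (h.pow_dvd_two_mul h.dvd_two).mul_right ((k : R) ^ 2) using 1
  ring

lemma injective_intCast (h : CubicArithmetic η) : Function.Injective (Int.cast : ℤ → R) := by
  obtain ⟨σ, -, -⟩ := h.real
  intro a b hab
  simpa using congrArg σ hab

variable [IsDomain R]

lemma mul_dvd_mul_left_iff (h : CubicArithmetic η) {x y : R} :
    (η - 1) * x ∣ (η - 1) * y ↔ x ∣ y :=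
  _root_.mul_dvd_mul_iff_left h.prime_two.ne_zero

lemma not_sq_dvd (h : CubicArithmetic η) {x : R} (hx : ¬ η - 1 ∣ x) :
    ¬ (η - 1) ^ 2 ∣ (η - 1) * x := by
  rwa [sq, h.mul_dvd_mul_left_iff]

/-- The square classes of units other than the trivial one are nontrivial modulo `(η - 1) ^ 4`. -/
lemma not_dvd_mul_sq_sub_sq (h : CubicArithmetic η) {e x y : R}
    (he : e = -1 ∨ e = η ∨ e = -η) (hx : ¬ η - 1 ∣ x) (hy : ¬ η - 1 ∣ y) :
    ¬ (η - 1) ^ 4 ∣ e * x ^ 2 - y ^ 2 := by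
  intro hd
  have key : (η - 1) ^ 2 ∣ e - 1 := by
    have h1 := (h.sq_dvd_sq_sub_one hx).mul_left e
    have h2 := h.sq_dvd_sq_sub_one hy
    have h3 := (pow_dvd_pow (η - 1) (by norm_num : 2 ≤ 4)).trans hd
    convert dvd_add (dvd_sub h3 h1) h2 using 1
    ring
  have h_one : ¬ η - 1 ∣ 1 := fun hh ↦ h.prime_two.not_isUnit (isUnit_of_dvd_one hh)
  rcases he with rfl | rfl | rfl
  · obtain ⟨w, hw⟩ := h.dvd_sub_of_odd hx hy
    have hxy := h.not_dvd_mul (h.not_dvd_mul h.not_dvd_eta hx) hy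
    obtain ⟨k, hk⟩ := hd
    have h1 : w ^ 2 + (η - 1) * (η * x * y) = -(η - 1) ^ 2 * k := by
      apply mul_left_cancel₀ (pow_ne_zero 2 h.prime_two.ne_zero)
      linear_combination -hk - x * y * h.two_eq - (x - y + (η - 1) * w) * hw
    obtain ⟨v, rfl⟩ : η - 1 ∣ w := by
      refine h.prime_two.dvd_of_dvd_pow (n := 2) ⟨-(η - 1) * k - η * x * y, ?_⟩
      linear_combination h1
    exact h.not_sq_dvd hxy ⟨-k - v ^ 2, by linear_combination h1⟩
  · exact h.not_sq_dvd h_one (by simpa using key)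
  · obtain ⟨k, hk⟩ := key
    exact h.not_sq_dvd h_one ⟨-k - η * (η - 1), by linear_combination -hk - h.two_eq⟩

/-- Every unit is a square up to `±1`, `±η`: the unit `η` is an odd power of a fundamental one, up
to sign. -/
lemma exists_unit_eq_mul_sq (h : CubicArithmetic η) (u : Rˣ) :
    ∃ e v : R, (e = 1 ∨ e = -1 ∨ e = η ∨ e = -η) ∧ (u : R) = e * v ^ 2 := by
  obtain ⟨u₀, hu₀⟩ := h.units
  have hodd_unit (v : Rˣ) : ¬ η - 1 ∣ (v : R) := fun hh ↦
    h.prime_two.not_isUnit (isUnit_of_dvd_unit hh v.isUnit)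
  have hnot (e : R) (w : Rˣ) (he : e = η ∨ e = -η) : e ≠ w ^ 2 := fun hh ↦ by
    refine h.not_dvd_mul_sq_sub_sq (x := 1) (.inr he) (hodd_unit 1) (hodd_unit w) ?_
    simp [hh]
  obtain ⟨ε, hε⟩ := h.isUnit_eta
  have hηpow : ∃ j : ℤ, (u₀ : Rˣ) ^ (2 * j + 1) = ε ∨ u₀ ^ (2 * j + 1) = -ε := by
    obtain ⟨k, hk⟩ := hu₀ ε
    rcases Int.even_or_odd' k with ⟨j, rfl | rfl⟩
    · rw [mul_comm, zpow_mul] at hk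
      rcases hk with hk | hk
      · exact absurd (by rw [← hε, hk]; rfl) (hnot η (u₀ ^ j) (.inl rfl))
      · exact absurd (by rw [← hε, hk, Units.val_neg, neg_neg]; rfl)
          (hnot (-η) (u₀ ^ j) (.inr rfl))
    · exact ⟨j, hk.imp Eq.symm fun hh ↦ by rw [hh, neg_neg]⟩
  obtain ⟨j, hj⟩ := hηpow
  obtain ⟨n, hn⟩ := hu₀ u
  rcases Int.even_or_odd' n with ⟨i, rfl | rfl⟩
  · have hval : ((u₀ ^ (2 * i) : Rˣ) : R) = ((u₀ ^ i : Rˣ) : R) ^ 2 := by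
      rw [mul_comm, zpow_mul]; rfl
    rcases hn with rfl | rfl
    · exact ⟨1, _, by simp, by rw [hval, one_mul]⟩
    · exact ⟨-1, _, by simp, by rw [Units.val_neg, hval, neg_one_mul]⟩
  · have hval : ((u₀ ^ (2 * i + 1) : Rˣ) : R) =
        ((u₀ ^ (2 * j + 1) : Rˣ) : R) * ((u₀ ^ (i - j) : Rˣ) : R) ^ 2 := by
      rw [← Units.val_pow_eq_pow_val, ← Units.val_mul, ← zpow_natCast, ← zpow_mul, ← zpow_add]
      congr 2
      push_cast
      ring
    rcases hn with rfl | rfl <;> rcases hj with hj | hj <;>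
      simp only [Units.val_neg, hval, hj, hε, neg_mul, neg_neg]
    · exact ⟨η, _, by simp, rfl⟩
    · exact ⟨-η, _, by simp, by rw [neg_mul]⟩
    · exact ⟨-η, _, by simp, by rw [neg_mul]⟩
    · exact ⟨η, _, by simp, rfl⟩

lemma eq_of_dvd (h : CubicArithmetic η) {e e' x y : R}
    (he : e = 1 ∨ e = -1 ∨ e = η ∨ e = -η) (he' : e' = 1 ∨ e' = -1 ∨ e' = η ∨ e' = -η)
    (hx : ¬ η - 1 ∣ x) (hy : ¬ η - 1 ∣ y)
    (hd : (η - 1) ^ 4 ∣ e * x ^ 2 - e' * y ^ 2) : e = e' := by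
  by_contra hne
  have h_one : ¬ η - 1 ∣ 1 := fun hh ↦ h.prime_two.not_isUnit (isUnit_of_dvd_one hh)
  obtain ⟨f, g, hf, hg, hfg⟩ : ∃ f g, (f = -1 ∨ f = η ∨ f = -η) ∧ ¬ η - 1 ∣ g ∧
      e * e' = f * g ^ 2 := by
    rcases he with rfl | rfl | rfl | rfl <;> rcases he' with rfl | rfl | rfl | rfl <;>
      first
      | exact absurd rfl hne
      | (refine ⟨-1, 1, by simp, h_one, ?_⟩; ring1)
      | (refine ⟨_, 1, .inr (.inl rfl), h_one, ?_⟩; ring1)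
      | (refine ⟨_, 1, .inr (.inr rfl), h_one, ?_⟩; ring1)
      | (refine ⟨-1, _, by simp, h.not_dvd_eta, ?_⟩; ring1)
  have hey : ¬ η - 1 ∣ e' * y := by rwa [(h.isUnit_of_mem he').dvd_mul_left]
  refine h.not_dvd_mul_sq_sub_sq hf (h.not_dvd_mul hg hx) hey ?_
  convert hd.mul_left e' using 1
  linear_combination -x ^ 2 * hfg

lemma exists_eq_mul_of_dvd_mul (h : CubicArithmetic η) {x y z : R} (hxy : η - 1 ∣ x * y)
    (hsub : y - x = (η - 1) * z) :
    ∃ x' y', x = (η - 1) * x' ∧ y = (η - 1) * y' ∧ y' - x' = z := by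
  have hd : η - 1 ∣ x ∧ η - 1 ∣ y := by
    rcases h.prime_two.dvd_or_dvd hxy with hx | hy
    · exact ⟨hx, (dvd_sub_left hx).1 ⟨z, hsub⟩⟩
    · exact ⟨(dvd_sub_right hy).1 ⟨z, hsub⟩, hy⟩
  obtain ⟨⟨x', rfl⟩, ⟨y', rfl⟩⟩ := hd
  refine ⟨x', y', rfl, rfl, mul_left_cancel₀ h.prime_two.ne_zero ?_⟩
  linear_combination hsub

/-- Local analysis at the prime above `2` of `x * y = (η - 1) ^ 4 * r ^ 2`, `y - x = 2 * a`. -/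
lemma local_factorization (h : CubicArithmetic η) {x y r a : R} (ha : ¬ η - 1 ∣ a)
    (hxy : x * y = (η - 1) ^ 4 * r ^ 2) (hsub : y - x = 2 * a) :
    ∃ s t, x = 2 * s ∧ y = 2 * t ∧
      (¬ η - 1 ∣ s ∧ η - 1 ∣ t ∨ η - 1 ∣ s ∧ ¬ η - 1 ∣ t) := by
  have hθ := h.prime_two
  have h0 := hθ.ne_zero
  have hηa := h.not_dvd_mul h.not_dvd_eta ha
  obtain ⟨x, y, rfl, rfl, hsub₁⟩ := h.exists_eq_mul_of_dvd_mul (x := x) (y := y)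
    (z := (η - 1) ^ 2 * (η * a)) ⟨(η - 1) ^ 3 * r ^ 2, by linear_combination hxy⟩
    (by linear_combination hsub + a * h.two_eq)
  replace hxy : x * y = (η - 1) ^ 2 * r ^ 2 := by
    apply mul_left_cancel₀ (pow_ne_zero 2 h0)
    linear_combination hxy
  obtain ⟨x, y, rfl, rfl, hsub₂⟩ := h.exists_eq_mul_of_dvd_mul (x := x) (y := y)
    (z := (η - 1) * (η * a)) ⟨(η - 1) * r ^ 2, by linear_combination hxy⟩
    (by linear_combination hsub₁)
  replace hxy : x * y = r ^ 2 := by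
    apply mul_left_cancel₀ (pow_ne_zero 2 h0)
    linear_combination hxy
  have hx : η - 1 ∣ x := by
    by_contra hx
    have hy : ¬ η - 1 ∣ y := fun hy ↦ hx ((dvd_sub_right hy).1 ⟨_, hsub₂⟩)
    have hr : ¬ η - 1 ∣ r := fun hr ↦
      h.not_dvd_mul hx hy (hxy ▸ dvd_pow hr two_ne_zero)
    apply h.not_sq_dvd (h.not_dvd_mul hx hηa)
    convert dvd_sub (h.sq_dvd_sq_sub_one hr) (h.sq_dvd_sq_sub_one hx) using 1
    linear_combination -x * hsub₂ + hxy
  obtain ⟨x, y, rfl, rfl, hsub₃⟩ := h.exists_eq_mul_of_dvd_mul (hx.mul_right y) hsub₂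
  obtain ⟨e, he⟩ := h.isUnit_eta.exists_right_inv
  have heu : IsUnit e := .of_mul_eq_one η (by rw [mul_comm, he])
  refine ⟨e * x, e * y, ?_, ?_, ?_⟩
  · linear_combination -(e * x) * h.two_eq - (η - 1) ^ 3 * x * he
  · linear_combination -(e * y) * h.two_eq - (η - 1) ^ 3 * y * he
  · rw [heu.dvd_mul_left, heu.dvd_mul_left]
    by_cases hx : η - 1 ∣ x
    · exact .inr ⟨hx, fun hy ↦ hηa (hsub₃ ▸ dvd_sub hy hx)⟩
    · exact .inl ⟨hx, by_contra fun hy ↦ hηa (hsub₃ ▸ h.dvd_sub_of_odd hy hx)⟩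

protected lemma two_ne_zero (h : CubicArithmetic η) : (2 : R) ≠ 0 := by
  rw [h.two_eq]
  exact mul_ne_zero h.isUnit_eta.ne_zero (pow_ne_zero 3 h.prime_two.ne_zero)

lemma exists_eq_sub (h : CubicArithmetic η) {a c r : R} (ha : ¬ η - 1 ∣ a)
    (hc : c ^ 2 = a ^ 2 + ((η - 1) ^ 2 * r) ^ 2) :
    ∃ s t, a = s - t ∧ c ^ 2 = (s + t) ^ 2 ∧ ¬ η - 1 ∣ s ∧ η - 1 ∣ t := by
  obtain ⟨s, t, hs, ht, hst⟩ := h.local_factorization (x := c - a) (y := c + a) (r := r) ha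
    (by linear_combination hc) (by ring)
  have hsum : c = s + t := mul_left_cancel₀ h.two_ne_zero (by linear_combination hs + ht)
  have hsub : a = t - s := mul_left_cancel₀ h.two_ne_zero (by linear_combination ht - hs)
  rcases hst with ⟨h1, h2⟩ | ⟨h1, h2⟩
  · exact ⟨-s, -t, by rw [hsub]; ring, by rw [hsum]; ring, by rwa [dvd_neg], by rwa [dvd_neg]⟩
  · exact ⟨t, s, hsub, by rw [hsum]; ring, h2, h1⟩

lemma dvd_of_sq_eq (h : CubicArithmetic η) {a b c : R} (ha : ¬ η - 1 ∣ a)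
    (hc : c ^ 2 = a ^ 2 + η ^ 2 * b ^ 2) : η - 1 ∣ b := by
  by_contra hb
  have h0 := h.prime_two.ne_zero
  have hη := h.not_dvd_eta
  obtain ⟨w, hw⟩ := h.dvd_add_of_odd ha (h.not_dvd_mul hη hb)
  have hxy : (c - (a + η * b)) * (c + (a + η * b)) = -(η - 1) ^ 3 * (η * η * a * b) := by
    linear_combination hc - η * a * b * h.two_eq
  obtain ⟨x, y, hx, hy, hsub⟩ := h.exists_eq_mul_of_dvd_mul (x := c - (a + η * b))
    (y := c + (a + η * b)) (z := (η - 1) * ((η - 1) * (η * (η - 1) * w)))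
    ⟨-(η - 1) ^ 2 * (η * η * a * b), by linear_combination hxy⟩
    (by linear_combination 2 * hw + (η - 1) * w * h.two_eq)
  rw [hx, hy] at hxy
  replace hxy : x * y = -(η - 1) * (η * η * a * b) := by
    apply mul_left_cancel₀ (pow_ne_zero 2 h0)
    linear_combination hxy
  obtain ⟨x, y, rfl, rfl, -⟩ := h.exists_eq_mul_of_dvd_mul (x := x) (y := y)
    ⟨-(η * η * a * b), by linear_combination hxy⟩ hsub
  refine h.not_dvd_mul (h.not_dvd_mul (h.not_dvd_mul hη hη) ha) hb ⟨-(x * y), ?_⟩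
  apply mul_left_cancel₀ h0
  linear_combination hxy

/-- The `2`-adic shape of a solution of `a² + η² b² = c²`, `a² + (η - 1)² b² = d²`. -/
lemma exists_halves (h : CubicArithmetic η) {a b c d : R} (ha : ¬ η - 1 ∣ a)
    (hc : c ^ 2 = a ^ 2 + η ^ 2 * b ^ 2) (hd : d ^ 2 = a ^ 2 + (η - 1) ^ 2 * b ^ 2) :
    ∃ β s₁ t₁ s₂ t₂, b = 2 * β ∧
      a = s₁ - t₁ ∧ s₁ * t₁ = (η * β) ^ 2 ∧ ¬ η - 1 ∣ s₁ ∧ η - 1 ∣ t₁ ∧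
      a = s₂ - t₂ ∧ s₂ * t₂ = ((η - 1) * β) ^ 2 ∧ ¬ η - 1 ∣ s₂ ∧ η - 1 ∣ t₂ := by
  have hθ := h.prime_two
  have h0 := hθ.ne_zero
  have h2 := h.two_ne_zero
  have hη := h.isUnit_eta.ne_zero
  obtain ⟨b, rfl⟩ := h.dvd_of_sq_eq ha hc
  obtain ⟨s₂, t₂, has₂, hd₂, hs₂, ht₂⟩ :=
    h.exists_eq_sub (c := d) (r := b) ha (by linear_combination hd)
  have e₂ : (η - 1) ^ 2 * (η ^ 2 * (s₂ * t₂)) = b ^ 2 := by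
    apply mul_left_cancel₀ (pow_ne_zero 4 h0)
    linear_combination hd - hd₂ + (a + s₂ - t₂) * has₂ - s₂ * t₂ * (2 + η * (η - 1) ^ 3) * h.two_eq
  obtain ⟨b, rfl⟩ := hθ.dvd_of_dvd_pow (Dvd.intro ((η - 1) * (η ^ 2 * (s₂ * t₂)))
    (by linear_combination e₂) : η - 1 ∣ b ^ 2)
  replace e₂ : η ^ 2 * (s₂ * t₂) = b ^ 2 := by
    apply mul_left_cancel₀ (pow_ne_zero 2 h0)
    linear_combination e₂
  obtain ⟨b, rfl⟩ := hθ.dvd_of_dvd_pow (n := 2) (e₂ ▸ (ht₂.mul_left s₂).mul_left _)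
  obtain ⟨s₁, t₁, has₁, hc₁, hs₁, ht₁⟩ :=
    h.exists_eq_sub (c := c) (r := η * (η - 1) * b) ha (by linear_combination hc)
  have e₁ : s₁ * t₁ = b ^ 2 := by
    apply mul_left_cancel₀ (pow_ne_zero 2 (mul_ne_zero hη (pow_ne_zero 3 h0)))
    linear_combination hc - hc₁ + (a + s₁ - t₁) * has₁ - s₁ * t₁ * (2 + η * (η - 1) ^ 3) * h.two_eq
  obtain ⟨b, rfl⟩ := hθ.dvd_of_dvd_pow (n := 2) (e₁ ▸ ht₁.mul_left s₁)
  obtain ⟨e, he⟩ := h.isUnit_eta.exists_right_inv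
  refine ⟨(η - 1) * e * b, s₁, t₁, s₂, t₂, ?_, has₁, ?_, hs₁, ht₁, has₂, ?_, hs₂, ht₂⟩
  · linear_combination -((η - 1) * e * b) * h.two_eq - (η - 1) ^ 4 * b * he
  · linear_combination e₁ - ((η - 1) * b) ^ 2 * (η * e + 1) * he
  · apply mul_left_cancel₀ (pow_ne_zero 2 hη)
    linear_combination e₂ - ((η - 1) ^ 2 * b) ^ 2 * (η * e + 1) * he

variable [IsPrincipalIdealRing R]

lemma isCoprime_of_mul_eq (h : CubicArithmetic η) {a s t β : R} (hab : IsCoprime a (2 * β))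
    (hc : (s - t) ^ 2 = a ^ 2 + η ^ 2 * (2 * β) ^ 2) (hst : s * t = (1 - 2 * η) * β ^ 2) :
    IsCoprime s t := by
  have hβ : IsCoprime a β := hab.of_mul_right_right
  have key {π : R} (hπ : Prime π) (hs : π ∣ s) (ht : π ∣ t) (hπβ : π ∣ β) : False := by
    have hπa : π ∣ a := by
      refine hπ.dvd_of_dvd_pow (n := 2) ?_
      have := dvd_sub ((dvd_sub hs ht).mul_left (s - t)) (hπβ.mul_left (4 * η ^ 2 * β))
      convert this using 1
      linear_combination -hc
    exact hπ.not_isUnit (hβ.isUnit_of_dvd' hπa hπβ)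
  refine isCoprime_of_prime_dvd ?_ fun π hπ hs ht ↦ ?_
  · rintro ⟨rfl, rfl⟩
    have hβ0 : β ^ 2 = 0 := by simpa [h.prime_eleven.ne_zero] using hst.symm
    refine key h.prime_two (dvd_zero _) (dvd_zero _) ?_
    rw [pow_eq_zero_iff two_ne_zero |>.1 hβ0]
    exact dvd_zero _
  · by_cases hπm : π ∣ 1 - 2 * η
    · have hm := (hπ.irreducible.dvd_comm h.prime_eleven.irreducible).1 hπm
      obtain ⟨⟨s, rfl⟩, ⟨t, rfl⟩⟩ := And.intro (hm.trans hs) (hm.trans ht)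
      refine key h.prime_eleven ⟨s, rfl⟩ ⟨t, rfl⟩
        (h.prime_eleven.dvd_of_dvd_pow (n := 2) ⟨s * t, ?_⟩)
      apply mul_left_cancel₀ h.prime_eleven.ne_zero
      linear_combination -hst
    · refine key hπ hs ht (hπ.dvd_of_dvd_pow (n := 2) ((hπ.dvd_or_dvd ?_).resolve_left hπm))
      rw [← hst]
      exact hs.mul_right t

/-- Coprime factors of a nonzero square are squares up to a common unit in `{±1, ±η}`. -/
lemma exists_eq_mul_sq (h : CubicArithmetic η) {s t r : R} (hst : IsCoprime s t) (hr : r ≠ 0)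
    (hmul : s * t = r ^ 2) : ∃ e p q : R, (e = 1 ∨ e = -1 ∨ e = η ∨ e = -η) ∧
      s = e * p ^ 2 ∧ t = e * q ^ 2 ∧ r = e * p * q := by
  obtain ⟨d, u, hu⟩ := exists_associated_pow_of_mul_eq_pow' hst hmul
  obtain ⟨e, v, he, hev⟩ := h.exists_unit_eq_mul_sq u
  obtain ⟨e', hee⟩ := (h.isUnit_of_mem he).exists_right_inv
  have hs : s = e * (d * v) ^ 2 := by rw [← hu, hev]; ring
  obtain ⟨r', rfl⟩ : d * v ∣ r := by
    rw [← IsIntegrallyClosed.pow_dvd_pow_iff two_ne_zero, ← hmul, hs]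
    exact ⟨e * t, by ring⟩
  have ht : e * t = r' ^ 2 := by
    apply mul_left_cancel₀ (pow_ne_zero 2 (left_ne_zero_of_mul hr))
    rw [← mul_pow, ← hmul, hs]; ring
  refine ⟨e, d * v, e' * r', he, hs, ?_, ?_⟩
  · linear_combination e' * ht - (t + e' * r' ^ 2) * hee
  · linear_combination -(d * v * r') * hee

/-- Any solution of `a² + η² b² = c²`, `a² + (η - 1)² b² = d²` with `a`, `b` coprime and `b ≠ 0`
comes from a solution in which `b` is halved. -/
lemma exists_half_solution (h : CubicArithmetic η) {a b c d : R} (hab : IsCoprime a b)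
    (ha : ¬ η - 1 ∣ a) (hb : b ≠ 0) (hc : c ^ 2 = a ^ 2 + η ^ 2 * b ^ 2)
    (hd : d ^ 2 = a ^ 2 + (η - 1) ^ 2 * b ^ 2) :
    ∃ β a' c' d', b = 2 * β ∧ ¬ η - 1 ∣ a' ∧ c' ^ 2 = a' ^ 2 + η ^ 2 * β ^ 2 ∧
      d' ^ 2 = a' ^ 2 + (η - 1) ^ 2 * β ^ 2 := by
  obtain ⟨β, s₁, t₁, s₂, t₂, rfl, has₁, hm₁, hs₁, ht₁, has₂, hm₂, hs₂, ht₂⟩ :=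
    h.exists_halves ha hc hd
  have hβ : β ≠ 0 := right_ne_zero_of_mul hb
  have hco₁ : IsCoprime s₁ t₁ := isCoprime_of_mul_eq_sq hab has₁ hm₁
    (mul_dvd_mul_right ⟨(η - 1) ^ 3, h.two_eq⟩ β)
  have hco₂ : IsCoprime s₂ t₂ := isCoprime_of_mul_eq_sq hab has₂ hm₂ (mul_dvd_mul_right h.dvd_two β)
  have hm₃ : (s₁ + t₂) * (t₂ - t₁) = (1 - 2 * η) * β ^ 2 := by
    linear_combination hm₂ - hm₁ + t₂ * has₂ - t₂ * has₁
  have hco₃ : IsCoprime (s₁ + t₂) (t₂ - t₁) :=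
    h.isCoprime_of_mul_eq hab (by linear_combination 4 * hm₁ - (a + s₁ - t₁) * has₁) hm₃
  have hs₃ : ¬ η - 1 ∣ s₁ + t₂ := by rwa [dvd_add_left ht₂]
  have ht₃ : η - 1 ∣ t₂ - t₁ := dvd_sub ht₂ ht₁
  obtain ⟨e, p₁, q₁, he, rfl, rfl, hr₁⟩ :=
    h.exists_eq_mul_sq hco₁ (mul_ne_zero h.isUnit_eta.ne_zero hβ) hm₁
  obtain ⟨e₂, p₂, q₂, he₂, rfl, rfl, hr₂⟩ :=
    h.exists_eq_mul_sq hco₂ (mul_ne_zero h.prime_two.ne_zero hβ) hm₂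
  have heu := h.isUnit_of_mem he
  obtain ⟨hp₁, hq₁⟩ := h.odd_even_of_unit_mul heu hs₁ ht₁
  obtain ⟨hp₂, hq₂⟩ := h.odd_even_of_unit_mul (h.isUnit_of_mem he₂) hs₂ ht₂
  have hpq₁ : ¬ η - 1 ∣ p₁ - q₁ := by rwa [dvd_sub_left hq₁]
  have hpq₂ : ¬ η - 1 ∣ p₂ - q₂ := by rwa [dvd_sub_left hq₂]
  obtain rfl : e = e₂ := by
    refine h.eq_of_dvd he he₂ hpq₁ hpq₂ ?_
    convert dvd_sub ((h.pow_dvd_two_mul hq₂).mul_left (e₂ * (p₂ - q₂)))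
      ((h.pow_dvd_two_mul hq₁).mul_left (e * (p₁ - q₁))) using 1
    linear_combination has₂ - has₁
  rcases h.prime_eleven.dvd_or_dvd (Dvd.intro _ hm₃.symm) with ⟨s₃, hs₃'⟩ | ⟨t₃, ht₃'⟩
  · rw [hs₃'] at hco₃ hs₃ hm₃
    obtain ⟨e₃, p₃, q₃, he₃, rfl, hq₃', -⟩ := h.exists_eq_mul_sq (r := β)
      hco₃.of_mul_left_right hβ
      (mul_left_cancel₀ h.prime_eleven.ne_zero (by linear_combination hm₃))
    rw [hq₃'] at ht₃
    obtain ⟨hp₃, hq₃⟩ := h.odd_even_of_unit_mul (h.isUnit_of_mem he₃)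
      (fun hh ↦ hs₃ (hh.mul_left _)) ht₃
    have hne : -e₃ = e := by
      refine h.eq_of_dvd ?_ he (x := p₃ - q₃) (by rwa [dvd_sub_left hq₃]) hpq₁ ?_
      · rcases he₃ with rfl | rfl | rfl | rfl <;> simp
      · convert dvd_add ((h.pow_dvd_two_mul (dvd_refl (η - 1))).mul_left (e₃ * p₃ ^ 2)) (dvd_add
          ((h.pow_dvd_two_mul hq₃).mul_left (e₃ * p₃)) ((h.pow_dvd_two_mul hq₁).mul_left (e * p₁)))
          using 1
        linear_combination hq₃' - hs₃'
    obtain ⟨σ, hσ, hση⟩ := h.real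
    have hsum : p₂ ^ 2 + q₂ ^ 2 + (1 - 2 * η) * p₃ ^ 2 + q₃ ^ 2 = 0 := by
      apply mul_left_cancel₀ heu.ne_zero
      linear_combination hs₃' + hq₃' + has₁ - has₂ + (-(1 - 2 * η) * p₃ ^ 2 - q₃ ^ 2) * hne
    apply_fun σ at hsum
    simp only [map_add, map_mul, map_pow, map_sub, map_one, map_ofNat, map_zero] at hsum
    have hzero : σ p₂ = 0 := by
      nlinarith [sq_nonneg (σ p₂), sq_nonneg (σ q₂), sq_nonneg (σ q₃), sq_nonneg (σ p₃),
        mul_nonneg (neg_nonneg.2 hση.le) (sq_nonneg (σ p₃))]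
    rw [(map_eq_zero_iff σ hσ).1 hzero] at hp₂
    exact absurd (dvd_zero _) hp₂
  · rw [ht₃'] at hco₃ ht₃ hm₃
    obtain ⟨e₃, p₃, q₃, he₃, hp₃', rfl, -⟩ := h.exists_eq_mul_sq (r := β)
      hco₃.of_mul_right_right hβ
      (mul_left_cancel₀ h.prime_eleven.ne_zero (by linear_combination hm₃))
    rw [hp₃'] at hs₃
    have h_eleven : ¬ η - 1 ∣ 1 - 2 * η := by
      rw [dvd_sub_left (h.dvd_two.mul_right η)]
      exact fun hh ↦ h.prime_two.not_isUnit (isUnit_of_dvd_one hh)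
    obtain ⟨hp₃, hq₃⟩ := h.odd_even_of_unit_mul (h.isUnit_of_mem he₃)
      hs₃ ((h.prime_two.dvd_or_dvd ht₃).resolve_left h_eleven)
    obtain rfl : e₃ = e := by
      refine h.eq_of_dvd he₃ he (x := p₃ - q₃) (by rwa [dvd_sub_left hq₃]) hpq₁ ?_
      convert dvd_sub ((h.pow_dvd_two_mul hq₁).mul_left (e * p₁))
        ((h.pow_dvd_two_mul hq₃).mul_left (e₃ * (p₃ - q₃ + η * q₃))) using 1
      linear_combination ht₃' - hp₃'
    have hp₁₃ : p₃ ^ 2 = p₁ ^ 2 + q₂ ^ 2 := by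
      apply mul_left_cancel₀ heu.ne_zero
      linear_combination -hp₃'
    have hp₂₃ : p₃ ^ 2 = p₂ ^ 2 + q₁ ^ 2 := by
      apply mul_left_cancel₀ heu.ne_zero
      linear_combination -hp₃' + has₂ - has₁
    refine ⟨β, e₃ * p₁ * p₂, e₃ * p₁ * p₃, e₃ * p₂ * p₃, rfl, ?_, ?_, ?_⟩
    · rw [mul_assoc, heu.dvd_mul_left]
      exact h.not_dvd_mul hp₁ hp₂
    · linear_combination (e₃ * p₁) ^ 2 * hp₂₃ - (η * β + e₃ * p₁ * q₁) * hr₁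
    · linear_combination (e₃ * p₂) ^ 2 * hp₁₃ - ((η - 1) * β + e₃ * p₂ * q₂) * hr₂

/-- The descent: `a² + η² b²` and `a² + (η - 1)² b²` are not both squares, for odd `a` and
`b ≠ 0`. -/
theorem eq_zero_of_sq_of_sq (h : CubicArithmetic η) {a b c d : R} (ha : ¬ η - 1 ∣ a)
    (hc : c ^ 2 = a ^ 2 + η ^ 2 * b ^ 2) (hd : d ^ 2 = a ^ 2 + (η - 1) ^ 2 * b ^ 2) : b = 0 := by
  by_contra hb
  obtain ⟨n, hn⟩ : ∃ n, ¬ (η - 1) ^ n ∣ b :=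
    (FiniteMultiplicity.of_prime_left h.prime_two hb).elim fun n hn ↦ ⟨_, hn⟩
  induction n generalizing a b c d with
  | zero => simp at hn
  | succ n ih =>
    classical
    let _ := IsBezout.toGCDDomain R
    obtain ⟨a', b', hga, hgb, hab⟩ := extract_gcd a b
    rw [gcd_isUnit_iff] at hab
    generalize gcd a b = g at hga hgb
    subst hga hgb
    have hg : g ≠ 0 := left_ne_zero_of_mul hb
    obtain ⟨c, rfl⟩ : g ∣ c := (IsIntegrallyClosed.pow_dvd_pow_iff _root_.two_ne_zero).1
      ⟨a' ^ 2 + η ^ 2 * b' ^ 2, by linear_combination hc⟩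
    obtain ⟨d, rfl⟩ : g ∣ d := (IsIntegrallyClosed.pow_dvd_pow_iff _root_.two_ne_zero).1
      ⟨a' ^ 2 + (η - 1) ^ 2 * b' ^ 2, by linear_combination hd⟩
    obtain ⟨β, a'', c'', d'', rfl, ha'', hc'', hd''⟩ := h.exists_half_solution (c := c) (d := d) hab
      (fun hh ↦ ha (hh.mul_left g)) (right_ne_zero_of_mul hb)
      (mul_left_cancel₀ (pow_ne_zero 2 hg) (by linear_combination hc))
      (mul_left_cancel₀ (pow_ne_zero 2 hg) (by linear_combination hd))
    refine ih ha'' hc'' hd'' (right_ne_zero_of_mul (right_ne_zero_of_mul hb)) fun hh ↦ hn ?_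
    rw [pow_succ', mul_left_comm]
    exact mul_dvd_mul h.dvd_two (hh.mul_left g)

/-- Over `ℤ[η]` the sextic `a⁶ - 5a⁴b² + 11a²b⁴ + b⁶` has the factor `a² + η⁴b²`, and this factor
is a square as soon as the sextic is one. -/
theorem eq_zero_of_sextic_eq_sq (h : CubicArithmetic η) {a b y : ℤ} (hab : IsCoprime a b)
    (hb : b ≠ 0) (hy : a ^ 6 - 5 * a ^ 4 * b ^ 2 + 11 * a ^ 2 * b ^ 4 + b ^ 6 = y ^ 2) :
    a = 0 := by
  have hpar := parity_of_sextic_eq_sq hab hy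
  have hy22 := isCoprime_of_sextic_eq_sq hab hy
  have hη4 := pow_ne_zero 4 h.isUnit_eta.ne_zero
  have hAG : ((a : R) ^ 2 + η ^ 4 * b ^ 2) *
      (a ^ 4 + (2 * η - 4) * a ^ 2 * b ^ 2 + (4 * η ^ 2 - 6 * η + 7) * b ^ 4) = (y : R) ^ 2 := by
    have := congrArg (Int.cast : ℤ → R) hy
    push_cast at this
    linear_combination this + ((-1 + η - 2 * η ^ 2 + 4 * η ^ 3) * b ^ 6 +
      (-4 - 2 * η + 2 * η ^ 2) * a ^ 2 * b ^ 4 + (1 + η) * a ^ 4 * b ^ 2) * h.cubic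
  have hco : IsCoprime ((a : R) ^ 2 + η ^ 4 * b ^ 2)
      (a ^ 4 + (2 * η - 4) * a ^ 2 * b ^ 2 + (4 * η ^ 2 - 6 * η + 7) * b ^ 4) := by
    have hAb : IsCoprime ((a : R) ^ 2 + η ^ 4 * b ^ 2) b := by
      convert (hab.intCast (R := R).pow_left (m := 2)).add_mul_right_left (η ^ 4 * b) using 1
      ring
    have hA22 : IsCoprime ((a : R) ^ 2 + η ^ 4 * b ^ 2) (22 ^ 4) := by
      refine (IsCoprime.of_isCoprime_of_dvd_left ?_ (Dvd.intro _ hAG)).pow_right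
      simpa using (hy22.intCast (R := R)).pow_left (m := 2)
    have hAf : IsCoprime ((a : R) ^ 2 + η ^ 4 * b ^ 2) (4 * (3 * η ^ 2 - 2 * η + 1)) :=
      hA22.of_isCoprime_of_dvd_right ⟨1331 * (6 - 14 * η + 4 * η ^ 2), by
        linear_combination -5324 * (12 * η - 38) * h.cubic⟩
    convert (hAf.mul_right (hAb.pow_right (n := 4))).add_mul_left_right
      ((a : R) ^ 2 + (2 * η - 4 - η ^ 4) * b ^ 2) using 1
    linear_combination (3 - η - 4 * η ^ 2 + η ^ 4 + η ^ 5) * b ^ 4 * h.cubic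
  have hy0 : (y : R) ≠ 0 := fun hy0 ↦ by
    rw [← Int.cast_zero, h.injective_intCast.eq_iff] at hy0
    rw [hy0, isCoprime_zero_left] at hy22
    exact absurd hy22 (by decide)
  obtain ⟨e, z, w, he, hz, hw, -⟩ := h.exists_eq_mul_sq hco hy0 hAG
  have hunit : IsUnit (η ^ 2 - 2 * η + 2) :=
    .of_mul_eq_one (η ^ 2) (by linear_combination (η - 1) * h.cubic)
  have hη := h.not_dvd_eta
  obtain ⟨hez, hodd⟩ : e = 1 ∧ ¬ η - 1 ∣ (a : R) ^ 2 - (η ^ 2 - 2 * η + 2) * b ^ 2 := by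
    have hz_odd (hA : ¬ η - 1 ∣ (a : R) ^ 2 + η ^ 4 * b ^ 2) : ¬ η - 1 ∣ z := fun hh ↦
      hA (hz ▸ (dvd_pow hh (by norm_num)).mul_left e)
    rcases hpar with ⟨ha, hb⟩ | ⟨ha, hb⟩
    · have ha' := h.not_dvd_intCast_of_odd ha
      have ha2 : ¬ η - 1 ∣ (a : R) ^ 2 := mt h.prime_two.dvd_of_dvd_pow ha'
      have hb2 : η - 1 ∣ (b : R) ^ 2 := dvd_pow (h.dvd_intCast_of_even hb) (by norm_num)
      refine ⟨h.eq_of_dvd he (.inl rfl) (hz_odd ?_) ha' ?_, ?_⟩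
      · rwa [dvd_add_left (hb2.mul_left _)]
      · rw [← hz]
        convert (h.pow_dvd_intCast_sq_of_even hb).mul_left (η ^ 4) using 1
        ring
      · rwa [dvd_sub_left (hb2.mul_left _)]
    · have hb' := h.not_dvd_intCast_of_odd hb
      have hb2 : ¬ η - 1 ∣ (b : R) ^ 2 := mt h.prime_two.dvd_of_dvd_pow hb'
      have ha2 : η - 1 ∣ (a : R) ^ 2 := dvd_pow (h.dvd_intCast_of_even ha) (by norm_num)
      have hηb : ¬ η - 1 ∣ η ^ 2 * b := h.not_dvd_mul (mt h.prime_two.dvd_of_dvd_pow hη) hb'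
      refine ⟨h.eq_of_dvd he (.inl rfl) (hz_odd ?_) hηb ?_, ?_⟩
      · rw [dvd_add_right ha2]
        exact h.not_dvd_mul (mt h.prime_two.dvd_of_dvd_pow hη) hb2
      · rw [← hz]
        convert h.pow_dvd_intCast_sq_of_even ha using 1
        ring
      · rwa [dvd_sub_right ha2, hunit.dvd_mul_left]
  subst hez
  have hzero := h.eq_zero_of_sq_of_sq (a := a ^ 2 - (η ^ 2 - 2 * η + 2) * b ^ 2)
    (b := (η - 1) ^ 2 * a * b) (c := w) (d := a ^ 2 + (η ^ 2 - 2 * η + 2) * b ^ 2) hodd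
    (by linear_combination -hw + ((-2 * η + 3 * η ^ 2 - η ^ 3) * a ^ 2 * b ^ 2 +
      (3 - η) * b ^ 4) * h.cubic)
    (by linear_combination (7 - 9 * η + 5 * η ^ 2 - η ^ 3) * a ^ 2 * b ^ 2 * h.cubic)
  have hb0 : (b : R) ≠ 0 := by rwa [← Int.cast_zero, Ne, h.injective_intCast.eq_iff]
  rw [← h.injective_intCast.eq_iff, Int.cast_zero]
  simpa [hb0, h.prime_two.ne_zero] using hzero

end CubicArithmetic

namespace NumberField

open Module Polynomial

section CubicField

lemma irreducible_cubic : Irreducible (X ^ 3 - X ^ 2 + X + 1 : ℚ[X]) := by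
  have hdeg : (X ^ 3 - X ^ 2 + X + 1 : ℚ[X]).natDegree = 3 := by compute_degree!
  refine irreducible_of_degree_le_three_of_not_isRoot (by simp [hdeg]) fun x hx ↦ ?_
  have hx' : x ^ 3 - x ^ 2 + x + 1 = 0 := by simpa using hx
  obtain ⟨n, rfl⟩ : ∃ n : ℤ, algebraMap ℤ ℚ n = x :=
    IsIntegrallyClosed.isIntegral_iff.1 ⟨X ^ 3 - X ^ 2 + X + 1, by monicity!, by simpa using hx'⟩
  have hn : n ^ 3 - n ^ 2 + n + 1 = 0 := by
    rw [eq_intCast] at hx'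
    exact_mod_cast hx'
  obtain ⟨k, rfl | rfl⟩ := Int.even_or_odd' n <;> ring_nf at hn <;> omega

lemma minpoly_eq {K : Type*} [Field K] [Algebra ℚ K] {η : K} (hη : η ^ 3 = η ^ 2 - η - 1) :
    minpoly ℚ η = X ^ 3 - X ^ 2 + X + 1 :=
  (minpoly.eq_of_irreducible_of_monic irreducible_cubic
    (by simp; linear_combination hη) (by monicity!)).symm

variable {K : Type*} [Field K] [Algebra ℚ K] {η : K}

lemma exists_basis (hη : η ^ 3 = η ^ 2 - η - 1) (hK : finrank ℚ K = 3) :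
    ∃ b : Basis (Fin 3) ℚ K, ∀ i, b i = η ^ (i : ℕ) := by
  have hdeg : (minpoly ℚ η).natDegree = 3 := by
    rw [minpoly_eq hη]; compute_degree!
  have hli := linearIndependent_pow (K := ℚ) η
  rw [hdeg] at hli
  exact ⟨basisOfLinearIndependentOfCardEqFinrank hli (by simp [hK]), by simp⟩

lemma leftMulMatrix_eq (hη : η ^ 3 = η ^ 2 - η - 1) {b : Basis (Fin 3) ℚ K}
    (hb : ∀ i, b i = η ^ (i : ℕ)) :
    Algebra.leftMulMatrix b η = !![0, 0, -1; 1, 0, -1; 0, 1, 1] := by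
  have h0 : η * b 0 = b 1 := by simp [hb]
  have h1 : η * b 1 = b 2 := by simp [hb]; ring
  have h2 : η * b 2 = b 2 - b 1 - b 0 := by simp [hb]; linear_combination hη
  ext i j
  rw [Algebra.leftMulMatrix_eq_repr_mul]
  fin_cases j <;> fin_cases i <;> simp [h0, h1, h2]

lemma norm_one_sub_two_mul (hη : η ^ 3 = η ^ 2 - η - 1) (hK : finrank ℚ K = 3) :
    Algebra.norm ℚ (1 - 2 * η) = 11 := by
  obtain ⟨b, hb⟩ := exists_basis hη hK
  rw [Algebra.norm_eq_matrix_det b]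
  simp only [two_mul, map_sub, map_add, map_one, leftMulMatrix_eq hη hb]
  simp [Matrix.det_fin_three]
  norm_num

lemma norm_sub_one (hη : η ^ 3 = η ^ 2 - η - 1) (hK : finrank ℚ K = 3) :
    Algebra.norm ℚ (η - 1) = -2 := by
  obtain ⟨b, hb⟩ := exists_basis hη hK
  rw [Algebra.norm_eq_matrix_det b]
  simp only [map_sub, map_one, leftMulMatrix_eq hη hb]
  simp [Matrix.det_fin_three]
  norm_num

lemma trace_pow (hη : η ^ 3 = η ^ 2 - η - 1) (hK : finrank ℚ K = 3) (n : ℕ) :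
    Algebra.trace ℚ K (η ^ n) = ((!![0, 0, -1; 1, 0, -1; 0, 1, 1] : Matrix _ _ ℚ) ^ n).trace := by
  obtain ⟨b, hb⟩ := exists_basis hη hK
  rw [Algebra.trace_eq_matrix_trace b, map_pow, leftMulMatrix_eq hη hb]

lemma discr_pow (hη : η ^ 3 = η ^ 2 - η - 1) (hK : finrank ℚ K = 3) :
    Algebra.discr ℚ (fun i : Fin 3 ↦ η ^ (i : ℕ)) = -44 := by
  rw [Algebra.discr_def, Matrix.det_fin_three]
  simp only [Algebra.traceMatrix_apply, Algebra.traceForm_apply, ← pow_add, trace_pow hη hK]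
  simp [Matrix.trace_fin_three, pow_succ]
  norm_num

end CubicField

section RingOfIntegers

variable {K : Type*} [Field K] {η : 𝓞 K}

lemma coe_cubic (hη : η ^ 3 = η ^ 2 - η - 1) : (η : K) ^ 3 = (η : K) ^ 2 - η - 1 := by
  simpa using congrArg (algebraMap (𝓞 K) K) hη

variable [NumberField K]

lemma abs_discr_le (hη : η ^ 3 = η ^ 2 - η - 1) (hK : finrank ℚ K = 3) : |discr K| ≤ 44 := by
  have hη' := coe_cubic hη
  let B : Basis (Fin 3) ℤ (𝓞 K) := finBasisOfFinrankEq ℤ (𝓞 K) (by rw [RingOfIntegers.rank, hK])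
  let v : Fin 3 → 𝓞 K := fun i ↦ η ^ (i : ℕ)
  have hv : Algebra.discr ℤ v = -44 := by
    have h := discr_pow hη' hK
    rw [Algebra.discr_def] at h ⊢
    rw [← Int.cast_inj (α := ℚ), Int.cast_det]
    convert h using 2
    · ext i j
      simp [Algebra.traceMatrix_apply, Algebra.traceForm_apply, Algebra.coe_trace_int, v]
    · simp
  have hmul : v = Matrix.vecMul B ((B.toMatrix v).map (algebraMap ℤ (𝓞 K))) := by
    ext1 j
    rw [← B.sum_toMatrix_smul_self v j]
    simp [Matrix.vecMul, dotProduct, mul_comm]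
  rw [hmul, Algebra.discr_of_matrix_vecMul, discr_eq_discr] at hv
  exact Int.le_of_dvd (by norm_num) ((abs_dvd _ _).2 ((Dvd.intro_left _ hv).trans (by norm_num)))

lemma nrComplexPlaces_eq_one (hη : η ^ 3 = η ^ 2 - η - 1) (hK : finrank ℚ K = 3) :
    InfinitePlace.nrComplexPlaces K = 1 := by
  have hcard := InfinitePlace.card_add_two_mul_card_eq_rank K
  suffices InfinitePlace.nrComplexPlaces K ≠ 0 by omega
  rw [Ne, nrComplexPlaces_eq_zero_iff]
  intro _
  have htr : Algebra.trace ℚ K ((η : K) ^ 2) = -1 := by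
    rw [trace_pow (coe_cubic hη) hK]
    simp [Matrix.trace_fin_three, pow_succ]
  have hsum := trace_eq_sum_embeddings ℂ (K := ℚ) (L := K) (x := (η : K) ^ 2)
  rw [htr] at hsum
  have hre := congrArg Complex.re hsum
  have hnonneg : 0 ≤ (∑ σ : K →ₐ[ℚ] ℂ, σ ((η : K) ^ 2)).re := by
    rw [Complex.re_sum]
    refine Finset.sum_nonneg fun σ _ ↦ ?_
    have hσ : (σ (η : K)).im = 0 := by
      exact Complex.conj_eq_iff_im.1
        (RingHom.congr_fun (IsTotallyReal.complexEmbedding_isReal (σ : K →+* ℂ)) (η : K))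
    rw [map_pow, sq, Complex.mul_re, hσ]
    nlinarith [sq_nonneg (σ (η : K)).re]
  rw [← hre] at hnonneg
  norm_num at hnonneg

lemma isPrincipalIdealRing_of_cubic (hη : η ^ 3 = η ^ 2 - η - 1) (hK : finrank ℚ K = 3) :
    IsPrincipalIdealRing (𝓞 K) := by
  apply RingOfIntegers.isPrincipalIdealRing_of_abs_discr_lt
  rw [nrComplexPlaces_eq_one hη hK, hK]
  have h44 : ((|discr K| : ℤ) : ℝ) ≤ 44 := by exact_mod_cast abs_discr_le hη hK
  refine lt_of_le_of_lt h44 ?_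
  have hπ := Real.pi_gt_three
  norm_num [Nat.factorial]
  nlinarith

lemma rank_eq_one (hη : η ^ 3 = η ^ 2 - η - 1) (hK : finrank ℚ K = 3) : Units.rank K = 1 := by
  have hcard := InfinitePlace.card_add_two_mul_card_eq_rank K
  have hone := nrComplexPlaces_eq_one hη hK
  rw [Units.rank, InfinitePlace.card_eq_nrRealPlaces_add_nrComplexPlaces]
  omega

lemma exists_fundamental_unit (hη : η ^ 3 = η ^ 2 - η - 1) (hK : finrank ℚ K = 3) :
    ∃ u₀ : (𝓞 K)ˣ, ∀ u : (𝓞 K)ˣ, ∃ n : ℤ, u = u₀ ^ n ∨ u = -u₀ ^ n := by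
  have hrank := rank_eq_one hη hK
  let i₀ : Fin (Units.rank K) := ⟨0, by omega⟩
  have hsub : Subsingleton (Fin (Units.rank K)) := by rw [hrank]; infer_instance
  refine ⟨Units.fundSystem K i₀, fun u ↦ ?_⟩
  obtain ⟨⟨ζ, n⟩, hu, -⟩ := Units.exist_unique_eq_mul_prod K u
  rw [Fintype.prod_subsingleton _ i₀] at hu
  refine ⟨n i₀, ?_⟩
  rcases Units.torsion_eq_one_or_neg_one_of_odd_finrank (by rw [hK]; decide) ζ with hζ | hζ <;>
    simp [hu, hζ]

lemma prime_of_norm {x : 𝓞 K} (n : ℤ) (hn : Prime n) (hx : Algebra.norm ℚ (x : K) = n) :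
    Prime x := by
  have hnorm : Algebra.norm ℤ x = n := by exact_mod_cast (Algebra.coe_norm_int x).trans hx
  refine Ideal.prime_of_irreducible_absNorm_span (fun h0 ↦ hn.ne_zero ?_) ?_
  · rw [← hnorm, h0, Algebra.norm_zero]
  · rw [Ideal.absNorm_span_singleton, hnorm]
    exact (Int.prime_iff_natAbs_prime.1 hn)

lemma dvd_or_dvd_sub_one_of_norm {x : 𝓞 K} (hx : Algebra.norm ℚ (x : K) = -2) (y : 𝓞 K) :
    x ∣ y ∨ x ∣ y - 1 := by
  have hnorm : Algebra.norm ℤ x = -2 := by exact_mod_cast (Algebra.coe_norm_int x).trans hx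
  have hcard : Nat.card (𝓞 K ⧸ Ideal.span {x}) = 2 := by
    rw [← Submodule.cardQuot_apply, ← Ideal.absNorm_apply, Ideal.absNorm_span_singleton, hnorm]
    rfl
  obtain ⟨z, hz0, hz⟩ := (Nat.card_eq_two_iff' (0 : 𝓞 K ⧸ Ideal.span {x})).1 hcard
  have : Nontrivial (𝓞 K ⧸ Ideal.span {x}) := ⟨z, 0, hz0⟩
  simp only [← Ideal.mem_span_singleton, ← Ideal.Quotient.eq_zero_iff_mem]
  refine or_iff_not_imp_left.2 fun hy ↦ ?_
  rw [map_sub, map_one, hz _ hy, hz 1 one_ne_zero, sub_self]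

lemma cubicArithmetic (hη : η ^ 3 = η ^ 2 - η - 1) (hK : finrank ℚ K = 3) (φ : K →+* ℝ)
    (hφ : φ η < 0) : CubicArithmetic η where
  cubic := hη
  prime_two := prime_of_norm (-2) Int.prime_two.neg (by
    simpa using norm_sub_one (coe_cubic hη) hK)
  residue := dvd_or_dvd_sub_one_of_norm (by simpa using norm_sub_one (coe_cubic hη) hK)
  prime_eleven := prime_of_norm 11 (Nat.prime_iff_prime_int.1 (by norm_num)) (by
    simpa [map_ofNat] using norm_one_sub_two_mul (coe_cubic hη) hK)
  units := exists_fundamental_unit hη hK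
  real := ⟨φ.comp (algebraMap (𝓞 K) K), φ.injective.comp RingOfIntegers.coe_injective, hφ⟩

end RingOfIntegers

open IntermediateField in
/-- The real root of `x³ - x² + x + 1` is negative and generates a cubic field. -/
lemma exists_cubicArithmetic : ∃ (K : Type) (_ : Field K) (_ : NumberField K) (η : 𝓞 K),
    IsPrincipalIdealRing (𝓞 K) ∧ CubicArithmetic η := by
  obtain ⟨r, hr, hroot⟩ : ∃ r ∈ Set.Icc (-1 : ℝ) 0, r ^ 3 - r ^ 2 + r + 1 = 0 :=
    intermediate_value_Icc (by norm_num) (by fun_prop) (by norm_num)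
  have hr0 : r < 0 := hr.2.lt_of_ne fun h0 ↦ by norm_num [h0] at hroot
  have hcubic : r ^ 3 = r ^ 2 - r - 1 := by linear_combination hroot
  have hint {L : Type} [Field L] {x : L} (hx : x ^ 3 = x ^ 2 - x - 1) : IsIntegral ℤ x :=
    ⟨X ^ 3 - X ^ 2 + X + 1, by monicity!, by simp [hx]; ring⟩
  have hrint : IsIntegral ℚ r := (hint hcubic).tower_top
  have : FiniteDimensional ℚ ℚ⟮r⟯ := adjoin.finiteDimensional hrint
  have : NumberField ℚ⟮r⟯ := { }
  have hK : finrank ℚ ℚ⟮r⟯ = 3 := by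
    rw [adjoin.finrank hrint, minpoly_eq hcubic]
    compute_degree!
  have hgen : AdjoinSimple.gen ℚ r ^ 3 = AdjoinSimple.gen ℚ r ^ 2 - AdjoinSimple.gen ℚ r - 1 :=
    Subtype.ext hcubic
  let η : 𝓞 ℚ⟮r⟯ := ⟨AdjoinSimple.gen ℚ r, hint hgen⟩
  have hη : η ^ 3 = η ^ 2 - η - 1 := RingOfIntegers.ext hgen
  exact ⟨ℚ⟮r⟯, inferInstance, this, η, isPrincipalIdealRing_of_cubic hη hK,
    cubicArithmetic hη hK (algebraMap ℚ⟮r⟯ ℝ) hr0⟩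

end NumberField

/-- the only affine rational points on the genus 2 curve
`Y² = X⁶ − 5X⁴ + 11X² + 1` are `(0, ±1)`. -/
theorem rational_points_genus_two_curve
    (X Y : ℚ) (h : Y ^ 2 = X ^ 6 - 5 * X ^ 4 + 11 * X ^ 2 + 1) :
    X = 0 ∧ (Y = 1 ∨ Y = -1) := by
  obtain ⟨K, _, _, η, _, hη⟩ := NumberField.exists_cubicArithmetic
  have hnum : X * X.den = X.num := X.mul_den_eq_num
  have hsq : (Y * X.den ^ 3) ^ 2 = ((X.num ^ 6 - 5 * X.num ^ 4 * X.den ^ 2 +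
      11 * X.num ^ 2 * X.den ^ 4 + X.den ^ 6 : ℤ) : ℚ) := by
    push_cast
    rw [← hnum, mul_pow, h]
    ring
  obtain ⟨y, hy⟩ := IsIntegrallyClosed.exists_algebraMap_eq_of_isIntegral_pow (R := ℤ) two_pos
    (hsq ▸ isIntegral_algebraMap : IsIntegral ℤ ((Y * X.den ^ 3) ^ 2))
  rw [← hy, eq_intCast] at hsq
  have hX : X = 0 := Rat.num_eq_zero.1 <| hη.eq_zero_of_sextic_eq_sq
    (a := X.num) (b := X.den) (y := y)
    X.isCoprime_num_den (by exact_mod_cast X.den_ne_zero)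
    (by exact_mod_cast hsq.symm)
  refine ⟨hX, sq_eq_one_iff.1 ?_⟩
  rw [h, hX]
  norm_num
end

section
/- Let α, b ∈ (0, π) be real numbers satisfying the relation sin b · cos α = √2 · cos b · sin α (equivalently tan b = √2 · tan α, the relation between the apex angle α and the bisector length b in an isosceles spherical triangle with two sides equal to π/2). If cos α, sin α, cos b and sin b are all rational, then α = π/2 and b = π/2. Consequently, the only isosceles spherical triangle with two half-meridian sides whose two remaining cevians are rational angle bisectors is the equilateral triangle with all sides and angles equal to π/2. -/
open Real

/-- The only angle in `(0, π)` with vanishing cosine is `π / 2`. -/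
theorem eq_pi_div_two_of_cos_eq_zero {x : ℝ} (h0 : 0 < x) (hπ : x < π) (h : Real.cos x = 0) :
    x = π / 2 :=
  Real.injOn_cos ⟨h0.le, hπ.le⟩ ⟨by positivity, by linarith [Real.pi_pos]⟩
    (by rw [h, Real.cos_pi_div_two])

/-- If a rational multiple of `√2` is rational, then it is zero. -/
theorem eq_zero_of_sqrt_two_mul_eq {p q : ℚ} (h : Real.sqrt 2 * (q : ℝ) = p) : q = 0 := by
  by_contra hq
  exact (irrational_sqrt_two.mul_ratCast hq).ne_rat p h

/-- the only isosceles spherical triangle with two half-meridian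
sides whose two remaining cevians are rational angle bisectors is the
equilateral triangle with all sides and angles `π/2`. Here `α` is the apex
angle and `b` the bisector length, related by `tan b = √2 · tan α`. -/
theorem isosceles_meridian_rational_bisector
    (α b : ℝ) (hα0 : 0 < α) (hαπ : α < π) (hb0 : 0 < b) (hbπ : b < π)
    (hlaw : Real.sin b * Real.cos α = Real.sqrt 2 * Real.cos b * Real.sin α)
    (hcα : ∃ q : ℚ, (q : ℝ) = Real.cos α)
    (hsα : ∃ q : ℚ, (q : ℝ) = Real.sin α)
    (hcb : ∃ q : ℚ, (q : ℝ) = Real.cos b)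
    (hsb : ∃ q : ℚ, (q : ℝ) = Real.sin b) :
    α = π / 2 ∧ b = π / 2 := by
  have hsinα := Real.sin_pos_of_pos_of_lt_pi hα0 hαπ
  have hsinb := Real.sin_pos_of_pos_of_lt_pi hb0 hbπ
  obtain ⟨cα, hcα⟩ := hcα
  obtain ⟨sα, hsα⟩ := hsα
  obtain ⟨cb, hcb⟩ := hcb
  obtain ⟨sb, hsb⟩ := hsb
  have hzero : cb * sα = 0 := by
    refine eq_zero_of_sqrt_two_mul_eq (p := sb * cα) ?_
    push_cast
    rw [hcα, hsα, hcb, hsb, hlaw, mul_assoc]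
  have hcosb : Real.cos b = 0 := by
    have h : Real.cos b * Real.sin α = 0 := by
      rw [← hcb, ← hsα]
      exact_mod_cast hzero
    exact (mul_eq_zero.mp h).resolve_right hsinα.ne'
  have hcosα : Real.cos α = 0 := by
    rw [hcosb, mul_zero, zero_mul] at hlaw
    exact (mul_eq_zero.mp hlaw).resolve_left hsinb.ne'
  exact ⟨eq_pi_div_two_of_cos_eq_zero hα0 hαπ hcosα, eq_pi_div_two_of_cos_eq_zero hb0 hbπ hcosb⟩
end
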